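/- Let N ≥ 2 and t ≥ 0 be integers, let R₀ = ℤ[1/N][x₁,…,x_t], let R be an integral domain containing R₀ that is finitely generated as an R₀-module, and let F be a number field that is Galois over ℚ. Then there exist a function h : R → ℝ_{≥0} and a constant C ≥ 1 such that: (1) for all r₁,…,r_m ∈ R, h(r₁+⋯+r_m) ≤ log_N(m) + max_i h(r_i), and h(r₁⋯r_m) ≤ m·C + (t+1)·∑_i h(r_i); (2) for every nonzero r ∈ R, if p is a prime number with p > C^{h(r)} then the image of r ⊗ 1 in R ⊗_ℤ 𝔽_p is not a zero divisor; (3) for every nonzero r ∈ R and every real number n ≥ max(N, h(r)) there exists a prime p with n ≤ p ≤ C·n such that p splits completely in F and the image of r ⊗ 1 in R ⊗_ℤ 𝔽_p is not a zero divisor. -/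

import Mathlib

open scoped TensorProduct

/-- `ℤ[1/N]`, the localization of `ℤ` away from `N`. -/
abbrev ZInv (N : ℕ) : Type := Localization.Away (N : ℤ)

/-- A prime number `p` splits completely in a number field `F` if the number of ring
homomorphisms from the ring of integers of `F` (the integral closure of `ℤ` in `F`)
to `𝔽_p` equals the degree `[F : ℚ]`. -/
def SplitsCompletely (F : Type*) [Field F] [Algebra ℚ F] (p : ℕ) : Prop :=
  Nat.card ((integralClosure ℤ F) →+* ZMod p) = Module.finrank ℚ F

section Lattice

variable {O ι : Type*} [CommRing O] [Fintype ι]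

/-- The elements of `O` whose coordinates with respect to `b` lie in the box `∏ [c i, c i + X)`. -/
def latticeBox (b : Module.Basis ι ℤ O) (c : ι → ℤ) (X : ℕ) : Set O :=
  {x | ∀ i, c i ≤ b.repr x i ∧ b.repr x i < c i + X}

/-- A box corresponds to a product of integer intervals. -/
noncomputable def latticeBoxEquiv (b : Module.Basis ι ℤ O) (c : ι → ℤ) (X : ℕ) :
    latticeBox b c X ≃ ((i : ι) → Finset.Ico (c i) (c i + X)) where
  toFun x i := ⟨b.repr x.1 i, Finset.mem_Ico.2 (x.2 i)⟩
  invFun f := ⟨b.equivFun.symm fun i => (f i : ℤ), fun i => by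
    have := Finset.mem_Ico.1 (f i).2
    rw [← b.equivFun_apply, LinearEquiv.apply_symm_apply]
    exact this⟩
  left_inv x := by
    ext
    exact b.equivFun.symm_apply_apply x.1
  right_inv f := by
    ext i
    change b.equivFun (b.equivFun.symm _) i = _
    rw [LinearEquiv.apply_symm_apply]

theorem finite_latticeBox (b : Module.Basis ι ℤ O) (c : ι → ℤ) (X : ℕ) :
    (latticeBox b c X).Finite :=
  Finite.of_equiv _ (latticeBoxEquiv b c X).symm

theorem ncard_latticeBox (b : Module.Basis ι ℤ O) (c : ι → ℤ) (X : ℕ) :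
    (latticeBox b c X).ncard = X ^ Fintype.card ι := by
  rw [← Nat.card_coe_set_eq, Nat.card_congr (latticeBoxEquiv b c X), Nat.card_pi]
  simp_rw [Nat.card_eq_fintype_card, Fintype.card_coe, Int.card_Ico]
  simp

theorem abs_repr_mul_le (b : Module.Basis ι ℤ O) :
    ∃ K : ℕ, ∀ (x y : O) (m n : ℤ), (∀ i, |b.repr x i| ≤ m) → (∀ i, |b.repr y i| ≤ n) →
      ∀ j, |b.repr (x * y) j| ≤ K * m * n := by
  refine ⟨∑ i, ∑ k, ∑ j, (b.repr (b i * b k) j).natAbs, fun x y m n hx hy j => ?_⟩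
  have hxy : x * y = ∑ i, ∑ k, (b.repr x i * b.repr y k) • (b i * b k) := by
    conv_lhs => rw [← b.sum_repr x, ← b.sum_repr y]
    rw [Finset.sum_mul_sum]
    refine Finset.sum_congr rfl fun i _ => Finset.sum_congr rfl fun k _ => ?_
    rw [smul_mul_smul_comm]
  rw [hxy]
  simp only [map_sum, Finsupp.coe_finsetSum, Finset.sum_apply, map_smul, Finsupp.smul_apply,
    smul_eq_mul]
  push_cast
  rw [mul_assoc, Finset.sum_mul]
  refine (Finset.abs_sum_le_sum_abs _ _).trans (Finset.sum_le_sum fun i _ => ?_)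
  rw [Finset.sum_mul]
  refine (Finset.abs_sum_le_sum_abs _ _).trans (Finset.sum_le_sum fun k _ => ?_)
  rw [abs_mul, abs_mul, mul_comm]
  have hm := (abs_nonneg _).trans (hx i)
  have h1 : |b.repr (b i * b k) j| ≤ ∑ l, |b.repr (b i * b k) l| :=
    Finset.single_le_sum (f := fun l => |b.repr (b i * b k) l|) (fun _ _ => abs_nonneg _)
      (Finset.mem_univ j)
  gcongr
  · exact hx i
  · exact hy k

variable [IsDedekindDomain O] [Module.Free ℤ O]

theorem exists_small_mem_ideal (b : Module.Basis ι ℤ O) (I : Ideal O) (m : ℕ)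
    (h0 : Ideal.absNorm I ≠ 0) (hm : Ideal.absNorm I < (m + 1) ^ Fintype.card ι) :
    ∃ x ∈ I, x ≠ 0 ∧ ∀ i, |b.repr x i| ≤ m := by
  have : Finite (O ⧸ I) := (Ideal.absNorm_ne_zero_iff I).1 h0
  have hfin := finite_latticeBox b 0 (m + 1)
  have hcard : (Set.univ : Set (O ⧸ I)).ncard < (latticeBox b 0 (m + 1)).ncard := by
    rw [ncard_latticeBox, Set.ncard_univ]
    exact hm
  obtain ⟨x, hx, y, hy, hne, hxy⟩ := Set.exists_ne_map_eq_of_ncard_lt_of_maps_to hcard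
    (f := Ideal.Quotient.mk I) (fun _ _ => Set.mem_univ _)
  refine ⟨x - y, Ideal.Quotient.eq.1 hxy, sub_ne_zero.2 hne, fun i => ?_⟩
  have h1 := hx i
  have h2 := hy i
  simp only [Pi.zero_apply, map_sub, Finsupp.sub_apply] at *
  push_cast at *
  rw [abs_le]
  constructor <;> omega

theorem exists_small_representative [CharZero O] [Module.Finite ℤ O] (b : Module.Basis ι ℤ O) :
    ∃ K : ℕ, ∀ (I : Ideal O) (m : ℕ), Ideal.absNorm I ≠ 0 →
      Ideal.absNorm I < (m + 1) ^ Fintype.card ι →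
      ∀ x : O, ∃ y : O, y - x ∈ I ∧ ∀ i, |b.repr y i| ≤ K * m := by
  obtain ⟨K, hK⟩ := abs_repr_mul_le b
  refine ⟨K, fun I m h0 hm x => ?_⟩
  obtain ⟨β, hβI, hβ0, hβ⟩ := exists_small_mem_ideal b I m h0 hm
  set n : ℕ := Ideal.absNorm (Ideal.span {β}) with hn
  have hn0 : 0 < n := by
    rw [Nat.pos_iff_ne_zero, hn, Ne, Ideal.absNorm_eq_zero_iff]
    simpa using hβ0
  obtain ⟨β', hβ'⟩ : β ∣ (n : O) := Ideal.mem_span_singleton.1 (Ideal.absNorm_mem _)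
  set z := x * β'
  set w : O := b.equivFun.symm fun i => b.repr z i / n
  set ρ : O := b.equivFun.symm fun i => b.repr z i % n
  have hz : z = n • w + ρ := by
    apply b.equivFun.injective
    ext i
    rw [map_add, map_nsmul]
    simp only [w, ρ, LinearEquiv.apply_symm_apply, Pi.add_apply, Pi.smul_apply]
    rw [nsmul_eq_mul]
    exact (Int.mul_ediv_add_emod _ _).symm
  refine ⟨x - β * w, by simpa using I.mul_mem_right w hβI, fun j => ?_⟩
  have hy : n • (x - β * w) = β * ρ := by
    have : (n : O) * x = β * z := by rw [hβ']; ring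
    rw [nsmul_eq_mul, mul_sub, this, hz, nsmul_eq_mul]
    ring
  have h1 := hK β ρ m n hβ (fun i => by
    simp only [ρ, ← b.equivFun_apply, LinearEquiv.apply_symm_apply]
    rw [abs_of_nonneg (Int.emod_nonneg _ (by omega))]
    exact (Int.emod_lt_of_pos _ (by omega)).le) j
  rw [← hy, map_nsmul, Finsupp.smul_apply, nsmul_eq_mul, abs_mul, mul_comm] at h1
  rw [Nat.abs_cast] at h1
  exact le_of_mul_le_mul_right h1 (by exact_mod_cast hn0)

theorem ncard_inter_latticeBox_le (b : Module.Basis ι ℤ O) (I : Ideal O) (h0 : Ideal.absNorm I ≠ 0)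
    (D : ℕ) (hD : ∀ x : O, ∃ y : O, y - x ∈ I ∧ ∀ i, |b.repr y i| ≤ D) (c : ι → ℤ) (X : ℕ) :
    Ideal.absNorm I * (latticeBox b c X ∩ I).ncard ≤ (X + 2 * D) ^ Fintype.card ι := by
  choose s hsI hs using hD
  have : Finite (O ⧸ I) := (Ideal.absNorm_ne_zero_iff I).1 h0
  rw [← ncard_latticeBox b (fun i => c i - D) (X + 2 * D), mul_comm]
  change _ * Nat.card (O ⧸ I) ≤ _
  rw [← Set.ncard_univ, ← Set.ncard_prod]
  refine Set.ncard_le_ncard_of_injOn (fun p => p.1 + s (Quotient.out p.2)) ?_ ?_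
    (finite_latticeBox _ _ _)
  · rintro ⟨x, u⟩ ⟨⟨hx, -⟩, -⟩ i
    have h1 := hx i
    have h2 := abs_le.1 (hs (Quotient.out u) i)
    simp only [map_add, Finsupp.add_apply] at *
    push_cast
    constructor <;> omega
  · rintro ⟨x, u⟩ ⟨⟨-, hx⟩, -⟩ ⟨y, v⟩ ⟨⟨-, hy⟩, -⟩ h
    have key (x : O) (hx : x ∈ I) (u : O ⧸ I) :
        Ideal.Quotient.mk I (x + s (Quotient.out u)) = u := by
      rw [map_add, Ideal.Quotient.eq_zero_iff_mem.2 hx, zero_add,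
        Ideal.Quotient.eq.2 (hsI (Quotient.out u))]
      exact Quotient.out_eq u
    have huv : u = v := by
      rw [← key x hx u, ← key y hy v]
      exact congrArg _ h
    subst huv
    simpa using h

theorem le_ncard_inter_latticeBox (b : Module.Basis ι ℤ O) (I : Ideal O)
    (h0 : Ideal.absNorm I ≠ 0)
    (D : ℕ) (hD : ∀ x : O, ∃ y : O, y - x ∈ I ∧ ∀ i, |b.repr y i| ≤ D) (c : ι → ℤ) (X : ℕ)
    (hX : 2 * D ≤ X) :
    (X - 2 * D) ^ Fintype.card ι ≤ Ideal.absNorm I * (latticeBox b c X ∩ I).ncard := by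
  choose s hsI hs using hD
  have : Finite (O ⧸ I) := (Ideal.absNorm_ne_zero_iff I).1 h0
  rw [← ncard_latticeBox b (fun i => c i + D) (X - 2 * D), mul_comm (Ideal.absNorm I)]
  change _ ≤ _ * Nat.card (O ⧸ I)
  rw [← Set.ncard_univ, ← Set.ncard_prod]
  refine Set.ncard_le_ncard_of_injOn
    (fun x => (x - s (Quotient.out (Ideal.Quotient.mk I x)), Ideal.Quotient.mk I x)) ?_ ?_
    (((finite_latticeBox _ _ _).inter_of_left _).prod Set.finite_univ)
  · intro x hx
    refine ⟨⟨fun i => ?_, ?_⟩, Set.mem_univ _⟩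
    · have h1 := hx i
      have h2 := abs_le.1 (hs (Quotient.out (Ideal.Quotient.mk I x)) i)
      simp only [map_sub, Finsupp.sub_apply]
      push_cast [Nat.cast_sub hX] at h1
      constructor <;> omega
    · apply Ideal.Quotient.eq.1
      rw [Ideal.Quotient.eq.2 (hsI _)]
      exact (Quotient.out_eq _).symm
  · intro x _ y _ h
    simp only [Prod.mk.injEq] at h
    rw [h.2] at h
    simpa using h.1

end Lattice

open NumberField in
theorem exists_latticeBox_norm_bounds (F : Type*) [Field F] [NumberField F]
    {ι : Type*} [Fintype ι] (b : Module.Basis ι ℤ (𝓞 F)) :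
    ∃ (c : ι → ℤ) (K : ℕ), 1 ≤ K ∧ ∀ X : ℕ, 1 ≤ X → ∀ x ∈ latticeBox b (fun i => X * c i) X,
      X ^ Module.finrank ℚ F ≤ Ideal.absNorm (Ideal.span {x}) ∧
      Ideal.absNorm (Ideal.span {x}) ≤ K * X ^ Module.finrank ℚ F := by
  let S : ℝ := ∑ σ : F →ₐ[ℚ] ℂ, ∑ i, ‖σ (b i)‖
  obtain ⟨M, hM⟩ := exists_nat_ge (S + 1)
  have hS (σ : F →ₐ[ℚ] ℂ) : ∑ i, ‖σ (b i)‖ ≤ S :=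
    Finset.single_le_sum (f := fun σ : F →ₐ[ℚ] ℂ => ∑ i, ‖σ (b i)‖)
      (fun _ _ => Finset.sum_nonneg fun _ _ => norm_nonneg _) (Finset.mem_univ σ)
  have hcard : Finset.card (Finset.univ : Finset (F →ₐ[ℚ] ℂ)) = Module.finrank ℚ F :=
    AlgHom.card ℚ F ℂ
  have hS0 : 0 ≤ S := Finset.sum_nonneg fun _ _ => Finset.sum_nonneg fun _ _ => norm_nonneg _
  have hM1 : 1 ≤ 2 * M := by
    have : (1 : ℝ) ≤ M := by linarith
    have : 1 ≤ M := by exact_mod_cast this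
    omega
  refine ⟨fun i => M * b.repr 1 i, (2 * M) ^ Module.finrank ℚ F, Nat.one_le_pow _ _ hM1,
    fun X hX x hx => ?_⟩
  have hnorm : (Ideal.absNorm (Ideal.span {x}) : ℝ) = ∏ σ : F →ₐ[ℚ] ℂ, ‖σ x‖ := by
    rw [Ideal.absNorm_span_singleton, ← norm_prod, ← Algebra.norm_eq_prod_embeddings ℚ ℂ (x : F),
      ← Algebra.coe_norm_int]
    simp [Nat.cast_natAbs]
  have hbound (σ : F →ₐ[ℚ] ℂ) : (X : ℝ) ≤ ‖σ x‖ ∧ ‖σ x‖ ≤ 2 * M * X := by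
    set y : 𝓞 F := x - ((X * M : ℕ) : 𝓞 F) with hy
    have hyrepr (i : ι) : |b.repr y i| ≤ X := by
      have h1 : b.repr y i = b.repr x i - X * (M * b.repr 1 i) := by
        rw [hy, ← nsmul_one, map_sub, map_nsmul]
        simp [mul_assoc]
      have h2 := hx i
      rw [h1, abs_le]
      constructor <;> linarith
    have hσy : ‖σ y‖ ≤ X * S := by
      rw [← b.sum_repr y]
      simp only [map_sum, zsmul_eq_mul, map_mul, map_intCast]
      refine (norm_sum_le _ _).trans ?_
      refine le_trans ?_ (mul_le_mul_of_nonneg_left (hS σ) (Nat.cast_nonneg X))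
      rw [Finset.mul_sum]
      refine Finset.sum_le_sum fun i _ => ?_
      rw [norm_mul, Complex.norm_intCast]
      gcongr
      exact_mod_cast hyrepr i
    have hσx : σ x = X * M + σ y := by
      simp [hy]
    have hXM : ‖(X * M : ℂ)‖ = X * M := by simp
    have hX0 : (0 : ℝ) ≤ X := Nat.cast_nonneg X
    rw [hσx]
    constructor
    · have := norm_sub_le_norm_add (X * M : ℂ) (σ y)
      rw [hXM] at this
      nlinarith
    · have := norm_add_le (X * M : ℂ) (σ y)
      rw [hXM] at this
      nlinarith
  constructor
  · have : (X : ℝ) ^ Module.finrank ℚ F ≤ ∏ σ : F →ₐ[ℚ] ℂ, ‖σ x‖ := by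
      rw [← hcard, ← Finset.prod_const]
      exact Finset.prod_le_prod (fun _ _ => Nat.cast_nonneg _) fun σ _ => (hbound σ).1
    rw [← hnorm] at this
    exact_mod_cast this
  · have : ∏ σ : F →ₐ[ℚ] ℂ, ‖σ x‖ ≤ (2 * M * X : ℝ) ^ Module.finrank ℚ F := by
      rw [← hcard, ← Finset.prod_const]
      exact Finset.prod_le_prod (fun _ _ => norm_nonneg _) fun σ _ => (hbound σ).2
    rw [← hnorm, mul_pow] at this
    exact_mod_cast this

section PrimePowers

variable (O : Type*) [CommRing O] [IsDedekindDomain O] [Module.Free ℤ O] [Module.Finite ℤ O]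
  [CharZero O]

/-- The pairs `(P, k)` with `P` a nonzero prime ideal, `k ≥ 1`, and `P ^ k` of norm `m`. -/
def primePowersOfNorm (m : ℕ) : Set (Ideal O × ℕ) :=
  {q | q.1.IsPrime ∧ q.1 ≠ ⊥ ∧ 1 ≤ q.2 ∧ Ideal.absNorm q.1 ^ q.2 = m}

variable {O}

omit [CharZero O] in
theorem one_lt_absNorm_of_isPrime {P : Ideal O} (hP : P.IsPrime)
    (h0 : P ≠ ⊥) : 1 < Ideal.absNorm P := by
  have h1 : Ideal.absNorm P ≠ 1 := fun h => hP.ne_top (Ideal.absNorm_eq_one_iff.1 h)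
  have h2 : Ideal.absNorm P ≠ 0 := fun h => h0 (Ideal.absNorm_eq_zero_iff.1 h)
  omega

theorem finite_primePowersOfNorm (m : ℕ) : (primePowersOfNorm O m).Finite := by
  refine ((Ideal.finite_setOfPred_absNorm_le (S := O) m).prod (Set.finite_Iic m)).subset ?_
  rintro ⟨P, k⟩ ⟨hP, h0, hk, hm⟩
  simp only at *
  have h1 := one_lt_absNorm_of_isPrime hP h0
  refine ⟨?_, ?_⟩
  · change Ideal.absNorm P ≤ m
    rw [← hm]
    exact Nat.le_self_pow (by omega) _
  · change k ≤ m
    rw [← hm]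
    exact (Nat.lt_pow_self h1).le

variable (O) in
/-- The sum of `log N(P)` over the pairs `(P, k)` with `N(P) ^ k = m`. -/
noncomputable def idealMangoldt (m : ℕ) : ℝ :=
  ∑ q ∈ (finite_primePowersOfNorm (O := O) m).toFinset, Real.log (Ideal.absNorm q.1)

theorem idealMangoldt_nonneg (m : ℕ) : 0 ≤ idealMangoldt O m :=
  Finset.sum_nonneg fun _ _ => Real.log_natCast_nonneg _

omit [CharZero O] in
theorem sum_log_absNorm_le_of_mem (p : ℕ) (hp : p ≠ 0) (T : Finset (Ideal O))
    (hT : ∀ P ∈ T, P.IsPrime ∧ P ≠ ⊥ ∧ (p : O) ∈ P) :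
    ∑ P ∈ T, Real.log (Ideal.absNorm P) ≤ Module.finrank ℤ O * Real.log p := by
  have hdvd : ∏ P ∈ T, P ∣ Ideal.span {(p : O)} := by
    refine Finset.prod_primes_dvd _ (fun P hP => ?_) fun P hP => ?_
    · exact (Ideal.prime_iff_isPrime (hT P hP).2.1).2 (hT P hP).1
    · exact Ideal.dvd_span_singleton.2 (hT P hP).2.2
  have h1 := map_dvd Ideal.absNorm hdvd
  rw [map_prod, Ideal.absNorm_span_natCast] at h1
  have h2 : ((∏ P ∈ T, Ideal.absNorm P : ℕ) : ℝ) ≤ (p : ℝ) ^ Module.finrank ℤ O := by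
    exact_mod_cast Nat.le_of_dvd (pow_pos (Nat.pos_of_ne_zero hp) _) h1
  have hne (P) (hP : P ∈ T) : (Ideal.absNorm P : ℝ) ≠ 0 := by
    have := one_lt_absNorm_of_isPrime (hT P hP).1 (hT P hP).2.1
    positivity
  rw [← Real.log_pow, ← Real.log_prod hne]
  refine Real.log_le_log ?_ (by exact_mod_cast h2)
  exact Finset.prod_pos fun P hP => lt_of_le_of_ne (Nat.cast_nonneg _) (hne P hP).symm

theorem idealMangoldt_le (m : ℕ) :
    idealMangoldt O m ≤ Module.finrank ℤ O * ArithmeticFunction.vonMangoldt m := by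
  classical
  rcases (primePowersOfNorm O m).eq_empty_or_nonempty with he | ⟨⟨P, k⟩, hP, h0, hk, hm⟩
  · have : (finite_primePowersOfNorm (O := O) m).toFinset = ∅ := by simpa using he
    rw [idealMangoldt, this, Finset.sum_empty]
    exact mul_nonneg (Nat.cast_nonneg _) ArithmeticFunction.vonMangoldt_nonneg
  simp only at *
  have : P.IsMaximal := hP.isMaximal h0
  obtain ⟨p, i, hi, -, hp, hpi⟩ := Ideal.exists_prime_and_absNorm_eq_pow P
  have hmp : m = p ^ (i * k) := by rw [← hm, hpi, pow_mul]
  have hik : i * k ≠ 0 := by positivity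
  have hΛ : ArithmeticFunction.vonMangoldt m = Real.log p := by
    rw [hmp, ArithmeticFunction.vonMangoldt_apply_pow hik,
      ArithmeticFunction.vonMangoldt_apply_prime hp]
  rw [hΛ, idealMangoldt]
  have hinj : Set.InjOn Prod.fst
      ((finite_primePowersOfNorm (O := O) m).toFinset : Set (Ideal O × ℕ)) := by
    rintro ⟨Q, k⟩ hQ ⟨Q', k'⟩ hQ' h
    simp only [Set.Finite.coe_toFinset] at hQ hQ' h
    subst h
    have h1 := hQ.2.2.2.trans hQ'.2.2.2.symm
    have h2 := Nat.pow_right_injective (one_lt_absNorm_of_isPrime hQ.1 hQ.2.1) h1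
    simp only at h2
    rw [h2]
  rw [← Finset.sum_image (f := fun Q : Ideal O => Real.log (Ideal.absNorm Q)) hinj]
  refine sum_log_absNorm_le_of_mem p hp.ne_zero _ fun Q hQ => ?_
  obtain ⟨⟨Q, k'⟩, hQ', rfl⟩ := Finset.mem_image.1 hQ
  replace hQ := (Set.Finite.mem_toFinset _).1 hQ'
  refine ⟨hQ.1, hQ.2.1, ?_⟩
  have h1 : ((m : ℕ) : O) ∈ Q := by
    rw [← hQ.2.2.2, Nat.cast_pow]
    exact Q.pow_mem_of_mem (Ideal.absNorm_mem Q) _ hQ.2.2.1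
  rw [hmp, Nat.cast_pow] at h1
  exact hQ.1.mem_of_pow_mem _ h1

theorem exists_absNorm_eq_of_idealMangoldt_ne_zero {p : ℕ} (hp : p.Prime)
    (h : idealMangoldt O p ≠ 0) : ∃ P : Ideal O, P.IsPrime ∧ Ideal.absNorm P = p := by
  obtain ⟨⟨P, k⟩, hq, -⟩ := Finset.exists_ne_zero_of_sum_ne_zero h
  rw [Set.Finite.mem_toFinset] at hq
  obtain ⟨hP, -, hk, hm⟩ := hq
  refine ⟨P, hP, ?_⟩
  simp only at *
  have : k = 1 := Nat.Prime.eq_one_of_pow (hm ▸ hp)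
  rwa [this, pow_one] at hm

open Classical in
theorem log_absNorm_eq_sum (I : Ideal O) (hI : I ≠ ⊥) (Y : ℕ) (hY : Ideal.absNorm I ≤ Y) :
    Real.log (Ideal.absNorm I) = ∑ m ∈ Finset.Icc 1 Y,
      ∑ q ∈ (finite_primePowersOfNorm (O := O) m).toFinset,
        if q.1 ^ q.2 ∣ I then Real.log (Ideal.absNorm q.1) else 0 := by
  set fs := UniqueFactorizationMonoid.normalizedFactors I with hfs
  have hIpos : 0 < Ideal.absNorm I :=
    Nat.pos_of_ne_zero fun h => hI (Ideal.absNorm_eq_zero_iff.1 h)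
  have hprime (P) (hP : P ∈ fs) : Prime P :=
    UniqueFactorizationMonoid.prime_of_normalized_factor P hP
  have hdvd (P : Ideal O) (hP : Prime P) (k : ℕ) : P ^ k ∣ I ↔ k ≤ fs.count P := by
    rw [pow_dvd_iff_le_emultiplicity,
      UniqueFactorizationMonoid.emultiplicity_eq_count_normalizedFactors hP.irreducible hI,
      normalize_eq, Nat.cast_le]
  have hlog : Real.log (Ideal.absNorm I) =
      ∑ P ∈ fs.toFinset, ∑ k ∈ Finset.Icc 1 (fs.count P), Real.log (Ideal.absNorm P) := by
    have h1 : Ideal.absNorm I = ∏ P ∈ fs.toFinset, Ideal.absNorm P ^ fs.count P := by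
      conv_lhs => rw [← associated_iff_eq.1 (UniqueFactorizationMonoid.prod_normalizedFactors hI)]
      rw [Finset.prod_multiset_count, map_prod]
      simp [hfs]
    rw [h1, Nat.cast_prod, Real.log_prod]
    · refine Finset.sum_congr rfl fun P _ => ?_
      simp
    · intro P hP
      have h2 := hprime P (Multiset.mem_toFinset.1 hP)
      have := one_lt_absNorm_of_isPrime (Ideal.isPrime_of_prime h2) h2.ne_zero
      positivity
  simp_rw [← Finset.sum_filter]
  rw [hlog, Finset.sum_sigma', Finset.sum_sigma']
  refine Finset.sum_bij' (fun x _ => ⟨Ideal.absNorm x.1 ^ x.2, (x.1, x.2)⟩)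
    (fun x _ => ⟨x.2.1, x.2.2⟩) ?_ ?_ (fun _ _ => rfl) ?_ (fun _ _ => rfl)
  · rintro ⟨P, k⟩ hPk
    simp only [Finset.mem_sigma, Multiset.mem_toFinset, Finset.mem_Icc] at hPk
    have hP := hprime P hPk.1
    have hPp := Ideal.isPrime_of_prime hP
    have hPk' : P ^ k ∣ I := (hdvd P hP k).2 hPk.2.2
    simp only [Finset.mem_sigma, Finset.mem_filter, Set.Finite.mem_toFinset, Finset.mem_Icc]
    refine ⟨⟨Nat.one_le_pow _ _ (one_lt_absNorm_of_isPrime hPp hP.ne_zero).le, ?_⟩,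
      ⟨hPp, hP.ne_zero, hPk.2.1, rfl⟩, hPk'⟩
    rw [← map_pow]
    exact (Nat.le_of_dvd hIpos (map_dvd _ hPk')).trans hY
  · rintro ⟨m, P, k⟩ hPk
    simp only [Finset.mem_sigma, Finset.mem_filter, Set.Finite.mem_toFinset] at hPk
    obtain ⟨-, ⟨hPp, hP0, hk, hm⟩, hd⟩ := hPk
    have hP := (Ideal.prime_iff_isPrime hP0).2 hPp
    have hcount := (hdvd P hP k).1 hd
    simp only [Finset.mem_sigma, Multiset.mem_toFinset, Finset.mem_Icc]
    exact ⟨Multiset.count_pos.1 (by simp only at hk; omega), hk, hcount⟩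
  · rintro ⟨m, P, k⟩ hPk
    simp only [Finset.mem_sigma, Finset.mem_filter, Set.Finite.mem_toFinset] at hPk
    obtain ⟨-, ⟨-, -, -, hm⟩, -⟩ := hPk
    simp only at hm
    subst hm
    rfl

end PrimePowers

section Analysis

theorem sum_mul_le_sum_mul_of_antitone (a b φ : ℕ → ℝ)
    (hab : ∀ Y, ∑ m ∈ Finset.Icc 1 Y, a m ≤ ∑ m ∈ Finset.Icc 1 Y, b m)
    (hφ0 : ∀ m, 0 ≤ φ m) (hφ : ∀ m, 1 ≤ m → φ (m + 1) ≤ φ m) (Y : ℕ) :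
    ∑ m ∈ Finset.Icc 1 Y, a m * φ m ≤ ∑ m ∈ Finset.Icc 1 Y, b m * φ m := by
  have key : (∑ m ∈ Finset.Icc 1 Y, b m - ∑ m ∈ Finset.Icc 1 Y, a m) * φ Y ≤
      ∑ m ∈ Finset.Icc 1 Y, b m * φ m - ∑ m ∈ Finset.Icc 1 Y, a m * φ m := by
    induction Y with
    | zero => simp
    | succ Y ih =>
      simp only [Finset.sum_Icc_succ_top (Nat.le_add_left 1 Y)]
      have h1 : (∑ m ∈ Finset.Icc 1 Y, b m - ∑ m ∈ Finset.Icc 1 Y, a m) * φ (Y + 1) ≤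
          (∑ m ∈ Finset.Icc 1 Y, b m - ∑ m ∈ Finset.Icc 1 Y, a m) * φ Y := by
        rcases Nat.eq_zero_or_pos Y with rfl | hY
        · simp
        · exact mul_le_mul_of_nonneg_left (hφ Y hY) (sub_nonneg.2 (hab Y))
      linarith
  have := mul_nonneg (sub_nonneg.2 (hab Y)) (hφ0 Y)
  linarith

theorem sum_rpow_sub_one_le {s : ℝ} (hs0 : 0 < s) (hs1 : s ≤ 1) (Y : ℕ) :
    ∑ m ∈ Finset.Icc 1 Y, (m : ℝ) ^ (s - 1) ≤ (Y : ℝ) ^ s / s := by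
  induction Y with
  | zero => simp [Real.zero_rpow hs0.ne']
  | succ Y ih =>
    rw [Finset.sum_Icc_succ_top (Nat.le_add_left 1 Y)]
    have hY : (0 : ℝ) < (Y + 1 : ℕ) := by positivity
    have h1 : (Y : ℝ) ^ s ≤ ((Y + 1 : ℕ) : ℝ) ^ s * (1 + s * (-1 / (Y + 1 : ℕ))) := by
      have h2 : (Y : ℝ) = (Y + 1 : ℕ) * (1 + -1 / (Y + 1 : ℕ)) := by
        field_simp
        push_cast
        ring
      have h3 : (-1 : ℝ) ≤ -1 / (Y + 1 : ℕ) := by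
        rw [le_div_iff₀ hY]
        push_cast
        linarith [(Nat.cast_nonneg Y : (0 : ℝ) ≤ Y)]
      conv_lhs => rw [h2]
      rw [Real.mul_rpow hY.le (by linarith)]
      gcongr
      exact rpow_one_add_le_one_add_mul_self h3 hs0.le hs1
    have h2 : ((Y + 1 : ℕ) : ℝ) ^ (s - 1) = ((Y + 1 : ℕ) : ℝ) ^ s / (Y + 1 : ℕ) :=
      Real.rpow_sub_one hY.ne' s
    rw [le_div_iff₀ hs0] at ih ⊢
    rw [add_mul, h2]
    have h3 : ((Y + 1 : ℕ) : ℝ) ^ s * (1 + s * (-1 / (Y + 1 : ℕ))) =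
      ((Y + 1 : ℕ) : ℝ) ^ s - ((Y + 1 : ℕ) : ℝ) ^ s / (Y + 1 : ℕ) * s := by ring
    linarith

theorem exists_sum_vonMangoldt_mul_rpow_le {s : ℝ} (hs0 : 0 < s) (hs1 : s ≤ 1) :
    ∃ K : ℝ, 0 ≤ K ∧ ∀ Y : ℕ, ∑ m ∈ Finset.Icc 1 Y,
      ArithmeticFunction.vonMangoldt m * (m : ℝ) ^ (s - 1) ≤ K * (Y : ℝ) ^ s := by
  refine ⟨(Real.log 4 + 4) / s, by positivity, fun Y => ?_⟩
  refine (sum_mul_le_sum_mul_of_antitone _ (fun _ => Real.log 4 + 4) _ (fun Y => ?_)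
    (fun m => by positivity) (fun m hm => ?_) Y).trans ?_
  · have := Chebyshev.psi_le_const_mul_self (x := Y) (Nat.cast_nonneg Y)
    rw [Chebyshev.psi, Nat.floor_natCast] at this
    simp only [Finset.sum_const, Nat.card_Icc, nsmul_eq_mul]
    rw [mul_comm]
    exact this
  · exact Real.rpow_le_rpow_of_nonpos (by positivity) (by push_cast; linarith) (by linarith)
  · rw [← Finset.mul_sum]
    refine (mul_le_mul_of_nonneg_left (sum_rpow_sub_one_le hs0 hs1 Y) (by positivity)).trans ?_
    rw [div_mul_eq_mul_div, mul_div_assoc]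

theorem summable_vonMangoldt_not_prime_div :
    Summable fun n : ℕ => (if n.Prime then 0 else ArithmeticFunction.vonMangoldt n) / (n : ℝ) := by
  have := ArithmeticFunction.vonMangoldt.summable_residueClass_non_primes_div (q := 1) 0
  refine this.congr fun n => ?_
  congr 2
  rw [ArithmeticFunction.vonMangoldt.residueClass, Set.indicator_of_mem]
  exact Subsingleton.elim _ _

theorem one_add_pow_le {u v : ℝ} (hu : 0 ≤ u) (huv : u ≤ v) (d : ℕ) :
    (1 + u) ^ d ≤ 1 + d * (1 + v) ^ d * u := by
  induction d with
  | zero => simp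
  | succ d ih =>
    have h1 : (1 + u) ^ d ≤ (1 + v) ^ d := by gcongr
    have h2 : (1 + v) ^ d ≤ (1 + v) ^ (d + 1) := pow_le_pow_right₀ (by linarith) (Nat.le_succ d)
    calc (1 + u) ^ (d + 1) = (1 + u) ^ d + (1 + u) ^ d * u := by ring
      _ ≤ (1 + d * (1 + v) ^ d * u) + (1 + v) ^ d * u := by gcongr
      _ = 1 + (d + 1) * (1 + v) ^ d * u := by ring
      _ ≤ _ := by push_cast; gcongr

theorem exists_pow_le_lt (d : ℕ) (hd : d ≠ 0) (n : ℕ) : ∃ X : ℕ, X ^ d ≤ n ∧ n < (X + 1) ^ d := by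
  induction n with
  | zero => exact ⟨0, by simp [hd], by simp⟩
  | succ n ih =>
    obtain ⟨X, h1, h2⟩ := ih
    rcases (Nat.succ_le_of_lt h2).lt_or_eq with h | h
    · exact ⟨X, h1.trans (Nat.le_succ n), h⟩
    · refine ⟨X + 1, h.symm.le, ?_⟩
      have : (X + 1) ^ d < (X + 1 + 1) ^ d := Nat.pow_lt_pow_left (Nat.lt_succ_self (X + 1)) hd
      omega

end Analysis

section LatticeCount

variable {O ι : Type*} [CommRing O] [Fintype ι] [IsDedekindDomain O] [Module.Free ℤ O]
  [CharZero O] [Module.Finite ℤ O]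

theorem exists_ncard_inter_latticeBox_bounds [Nonempty ι] (b : Module.Basis ι ℤ O) (K₁ : ℕ) :
    ∃ K : ℝ, 0 ≤ K ∧ ∀ (I : Ideal O), I ≠ ⊥ → ∀ (c : ι → ℤ) (X : ℕ), 1 ≤ X →
      Ideal.absNorm I ≤ K₁ * X ^ Fintype.card ι →
      (X : ℝ) ^ Fintype.card ι / Ideal.absNorm I *
          (1 - K * (Ideal.absNorm I : ℝ) ^ (1 / (Fintype.card ι : ℝ)) / X) ≤
        (latticeBox b c X ∩ I).ncard ∧
      (latticeBox b c X ∩ I).ncard ≤ (X : ℝ) ^ Fintype.card ι / Ideal.absNorm I *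
          (1 + K * (Ideal.absNorm I : ℝ) ^ (1 / (Fintype.card ι : ℝ)) / X) := by
  obtain ⟨K₀, hK₀⟩ := exists_small_representative b
  set d := Fintype.card ι with hd
  have hd0 : d ≠ 0 := Fintype.card_ne_zero
  have hd1 : (1 : ℝ) ≤ d := by exact_mod_cast Nat.one_le_iff_ne_zero.2 hd0
  set v : ℝ := 2 * K₀ * (K₁ : ℝ) ^ (1 / (d : ℝ)) with hv
  have hv0 : 0 ≤ v := by positivity
  refine ⟨2 * K₀ * (d * (1 + v) ^ d), by positivity, fun I hI c X hX hIX => ?_⟩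
  set q := Ideal.absNorm I with hq
  have hq0 : q ≠ 0 := fun h => hI (Ideal.absNorm_eq_zero_iff.1 h)
  have hqpos : (0 : ℝ) < q := by positivity
  have hXpos : (0 : ℝ) < X := by positivity
  obtain ⟨m, hm1, hm2⟩ := exists_pow_le_lt d hd0 q
  have hD := hK₀ I m hq0 hm2
  set D := K₀ * m with hDdef
  replace hD : ∀ x : O, ∃ y : O, y - x ∈ I ∧ ∀ i, |b.repr y i| ≤ D := by
    simpa [hDdef] using hD
  have hm : (m : ℝ) ≤ (q : ℝ) ^ (1 / (d : ℝ)) := by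
    rw [one_div]
    rw [← Real.pow_rpow_inv_natCast (Nat.cast_nonneg m) hd0]
    exact Real.rpow_le_rpow (by positivity) (by exact_mod_cast hm1) (by positivity)
  set ρ := (q : ℝ) ^ (1 / (d : ℝ)) with hρ
  have hρ0 : 0 ≤ ρ := by positivity
  set u : ℝ := 2 * D / X with hu
  have hu0 : 0 ≤ u := by positivity
  have huρ : u ≤ 2 * K₀ * ρ / X := by
    rw [hu, hDdef]
    push_cast
    rw [← mul_assoc]
    gcongr
  have huX : X * u = 2 * D := by rw [hu]; field_simp
  have huv : u ≤ v := by
    refine huρ.trans ?_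
    rw [hv, mul_div_assoc]
    gcongr
    rw [div_le_iff₀ hXpos, hρ]
    have h1 : (q : ℝ) ≤ K₁ * (X : ℝ) ^ d := by exact_mod_cast hIX
    calc (q : ℝ) ^ (1 / (d : ℝ)) ≤ (K₁ * (X : ℝ) ^ d) ^ (1 / (d : ℝ)) := by gcongr
      _ = _ := by
        rw [Real.mul_rpow (by positivity) (by positivity), one_div,
          Real.pow_rpow_inv_natCast hXpos.le hd0]
  have hvd : 1 ≤ (1 + v) ^ d := one_le_pow₀ (by linarith)
  have hdu : (d * (1 + v) ^ d) * u ≤ 2 * K₀ * (d * (1 + v) ^ d) * ρ / X := by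
    calc (d * (1 + v) ^ d) * u ≤ (d * (1 + v) ^ d) * (2 * K₀ * ρ / X) := by gcongr
      _ = _ := by ring
  have hdu' : d * u ≤ (d * (1 + v) ^ d) * u := by
    gcongr
    exact le_mul_of_one_le_right (by positivity) hvd
  constructor
  · rw [div_mul_eq_mul_div, div_le_iff₀ hqpos]
    by_cases hDX : 2 * D ≤ X
    · have h1 := le_ncard_inter_latticeBox b I hq0 D hD c X hDX
      have h2 : ((X : ℝ) - 2 * D) ^ d ≤ q * (latticeBox b c X ∩ I).ncard := by
        have h3 : (((X - 2 * D : ℕ) : ℝ)) ^ d ≤ q * (latticeBox b c X ∩ I).ncard := by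
          exact_mod_cast h1
        rwa [Nat.cast_sub hDX, Nat.cast_mul] at h3
      have hu1 : u ≤ 1 := by
        rw [hu, div_le_one hXpos]
        exact_mod_cast hDX
      have h3 : ((X : ℝ) - 2 * D) ^ d = X ^ d * (1 + -u) ^ d := by
        rw [← mul_pow, ← huX]
        ring
      have h4 := one_add_mul_le_pow (a := -u) (by linarith) d
      rw [mul_comm _ (q : ℝ)]
      refine le_trans ?_ h2
      rw [h3]
      gcongr
      linarith
    · have hu1 : 1 ≤ u := by
        rw [hu, le_div_iff₀ hXpos]
        have : (X : ℝ) ≤ 2 * D := by exact_mod_cast (not_le.1 hDX).le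
        linarith
      have h1 : u ≤ d * u := le_mul_of_one_le_left hu0 hd1
      refine le_trans (mul_nonpos_of_nonneg_of_nonpos (by positivity) (by linarith))
        (by positivity)
  · rw [div_mul_eq_mul_div, le_div_iff₀ hqpos]
    have h1 := ncard_inter_latticeBox_le b I hq0 D hD c X
    have h2 : (q : ℝ) * (latticeBox b c X ∩ I).ncard ≤ ((X : ℝ) + 2 * D) ^ d := by
      exact_mod_cast h1
    have h3 : ((X : ℝ) + 2 * D) ^ d = X ^ d * (1 + u) ^ d := by
      rw [← mul_pow, ← huX]
      ring
    rw [mul_comm _ (q : ℝ)]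
    refine h2.trans ?_
    rw [h3]
    gcongr
    exact (one_add_pow_le hu0 huv d).trans (by linarith)

end LatticeCount

section Mertens

open NumberField

variable (F : Type*) [Field F] [NumberField F]

variable {F} in
theorem sum_log_absNorm_latticeBox {ι : Type*} [Fintype ι] (b : Module.Basis ι ℤ (𝓞 F))
    (c : ι → ℤ) (X Y : ℕ)
    (h : ∀ x ∈ latticeBox b c X, x ≠ 0 ∧ Ideal.absNorm (Ideal.span {x}) ≤ Y) :
    ∑ x ∈ (finite_latticeBox b c X).toFinset, Real.log (Ideal.absNorm (Ideal.span {x})) =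
      ∑ m ∈ Finset.Icc 1 Y, ∑ q ∈ (finite_primePowersOfNorm (O := 𝓞 F) m).toFinset,
        Real.log (Ideal.absNorm q.1) *
          (latticeBox b c X ∩ (q.1 ^ q.2 : Ideal (𝓞 F)) : Set (𝓞 F)).ncard := by
  classical
  rw [Finset.sum_congr rfl fun x hx => log_absNorm_eq_sum (Ideal.span {x})
    (by simpa using (h x ((Set.Finite.mem_toFinset _).1 hx)).1) Y
    (h x ((Set.Finite.mem_toFinset _).1 hx)).2, Finset.sum_comm]
  refine Finset.sum_congr rfl fun m _ => ?_
  rw [Finset.sum_comm]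
  refine Finset.sum_congr rfl fun q _ => ?_
  rw [← Finset.sum_filter, Finset.sum_const, nsmul_eq_mul, mul_comm, ← Set.ncard_coe_finset]
  congr 3
  ext x
  simp [Ideal.dvd_span_singleton]

theorem exists_abs_sum_idealMangoldt_div_sub_le :
    ∃ (K₁ : ℕ) (K : ℝ), 1 ≤ K₁ ∧ ∀ X : ℕ, 1 ≤ X →
      |∑ m ∈ Finset.Icc 1 (K₁ * X ^ Module.finrank ℚ F), idealMangoldt (𝓞 F) m / m -
        Module.finrank ℚ F * Real.log X| ≤ K := by
  set b := RingOfIntegers.basis F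
  obtain ⟨c, K₁, hK₁, hbox⟩ := exists_latticeBox_norm_bounds F b
  have hcard : Fintype.card (Module.Free.ChooseBasisIndex ℤ (𝓞 F)) = Module.finrank ℚ F := by
    rw [← Module.finrank_eq_card_basis b, RingOfIntegers.rank]
  have hne : Nonempty (Module.Free.ChooseBasisIndex ℤ (𝓞 F)) := by
    rw [← Fintype.card_pos_iff, hcard]
    exact Module.finrank_pos
  obtain ⟨K₂, hK₂, hcount⟩ := exists_ncard_inter_latticeBox_bounds b K₁
  rw [hcard] at hcount
  set d := Module.finrank ℚ F with hd
  have hd0 : d ≠ 0 := Module.finrank_pos.ne'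
  have hd1 : (1 : ℝ) ≤ d := by exact_mod_cast Nat.one_le_iff_ne_zero.2 hd0
  obtain ⟨K₃, hK₃, hΛ⟩ := exists_sum_vonMangoldt_mul_rpow_le (s := 1 / (d : ℝ)) (by positivity)
    ((div_le_one (by positivity)).2 hd1)
  refine ⟨K₁, K₂ * (d * (K₃ * (K₁ : ℝ) ^ (1 / (d : ℝ)))) + Real.log K₁, hK₁, fun X hX => ?_⟩
  have hXpos : (0 : ℝ) < X := by positivity
  set Y := K₁ * X ^ d with hY
  set a := idealMangoldt (𝓞 F) with ha
  set B := latticeBox b (fun i => X * c i) X with hB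
  set S := ∑ x ∈ (finite_latticeBox b (fun i => X * c i) X).toFinset,
    Real.log (Ideal.absNorm (Ideal.span {x})) with hS
  set A := ∑ m ∈ Finset.Icc 1 Y, a m / m with hA
  set E := ∑ m ∈ Finset.Icc 1 Y, a m * (m : ℝ) ^ (1 / (d : ℝ) - 1) with hE
  have hBcard : ((finite_latticeBox b (fun i => X * c i) X).toFinset.card : ℝ) = (X : ℝ) ^ d := by
    rw [← Set.ncard_eq_toFinset_card _ (finite_latticeBox _ _ _), ncard_latticeBox, hcard]
    push_cast
    rfl
  have hXd : (X : ℝ) ^ d ≠ 0 := by positivity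
  have hlogX : Real.log ((X : ℝ) ^ d) = d * Real.log X := by rw [Real.log_pow]
  have hS1 : (X : ℝ) ^ d * (d * Real.log X) ≤ S := by
    rw [← hBcard, ← nsmul_eq_mul]
    refine Finset.card_nsmul_le_sum _ _ _ fun x hx => ?_
    rw [← hlogX]
    have := (hbox X hX x ((Set.Finite.mem_toFinset _).1 hx)).1
    exact Real.log_le_log (by positivity) (by exact_mod_cast this)
  have hS2 : S ≤ (X : ℝ) ^ d * (d * Real.log X + Real.log K₁) := by
    rw [← hBcard, ← nsmul_eq_mul]
    refine Finset.sum_le_card_nsmul _ _ _ fun x hx => ?_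
    rw [← hlogX, ← Real.log_mul hXd (by positivity)]
    have h1 := hbox X hX x ((Set.Finite.mem_toFinset _).1 hx)
    have h2 : 0 < Ideal.absNorm (Ideal.span {x}) := lt_of_lt_of_le (by positivity) h1.1
    refine Real.log_le_log (by positivity) ?_
    rw [mul_comm]
    exact_mod_cast h1.2
  have hSeq := sum_log_absNorm_latticeBox b (fun i => X * c i) X Y fun x hx => by
    have h1 := hbox X hX x hx
    refine ⟨?_, h1.2⟩
    rintro rfl
    have h2 := h1.1
    rw [Ideal.span_singleton_eq_bot.2 rfl, Ideal.absNorm_bot] at h2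
    exact absurd h2 (not_le.2 (by positivity))
  have hterm (m : ℕ) (hm : m ∈ Finset.Icc 1 Y) (q : Ideal (𝓞 F) × ℕ)
      (hq : q ∈ (finite_primePowersOfNorm (O := 𝓞 F) m).toFinset) :
      (X : ℝ) ^ d / m * (1 - K₂ * (m : ℝ) ^ (1 / (d : ℝ)) / X) ≤
        (B ∩ (q.1 ^ q.2 : Ideal (𝓞 F)) : Set (𝓞 F)).ncard ∧
      (B ∩ (q.1 ^ q.2 : Ideal (𝓞 F)) : Set (𝓞 F)).ncard ≤
        (X : ℝ) ^ d / m * (1 + K₂ * (m : ℝ) ^ (1 / (d : ℝ)) / X) := by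
    obtain ⟨-, h0, -, hqm⟩ := (Set.Finite.mem_toFinset _).1 hq
    rw [← map_pow] at hqm
    have := hcount (q.1 ^ q.2) (pow_ne_zero _ h0) (fun i => X * c i) X hX
      (by rw [hqm]; exact (Finset.mem_Icc.1 hm).2)
    rwa [hqm] at this
  have hsum (ε : ℝ) : ∑ m ∈ Finset.Icc 1 Y, ∑ q ∈ (finite_primePowersOfNorm (O := 𝓞 F) m).toFinset,
      Real.log (Ideal.absNorm q.1) *
        ((X : ℝ) ^ d / m * (1 + ε * (K₂ * (m : ℝ) ^ (1 / (d : ℝ)) / X))) =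
      (X : ℝ) ^ d * (A + ε * (K₂ / X * E)) := by
    rw [hA, hE, Finset.mul_sum, Finset.mul_sum, ← Finset.sum_add_distrib, Finset.mul_sum]
    refine Finset.sum_congr rfl fun m hm => ?_
    have hm0 : (m : ℝ) ≠ 0 := by
      have := (Finset.mem_Icc.1 hm).1
      positivity
    rw [← Finset.sum_mul, Real.rpow_sub_one hm0]
    change a m * _ = _
    field_simp
  have hE1 : K₂ / X * E ≤ K₂ * (d * (K₃ * (K₁ : ℝ) ^ (1 / (d : ℝ)))) := by
    rw [div_mul_eq_mul_div, div_le_iff₀ hXpos, mul_assoc]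
    refine mul_le_mul_of_nonneg_left ?_ hK₂
    calc E ≤ d * ∑ m ∈ Finset.Icc 1 Y,
          ArithmeticFunction.vonMangoldt m * (m : ℝ) ^ (1 / (d : ℝ) - 1) := by
          rw [Finset.mul_sum]
          refine Finset.sum_le_sum fun m _ => ?_
          rw [← mul_assoc]
          have := idealMangoldt_le (O := 𝓞 F) m
          rw [RingOfIntegers.rank] at this
          gcongr
      _ ≤ d * (K₃ * (Y : ℝ) ^ (1 / (d : ℝ))) := by
          gcongr
          exact hΛ Y
      _ = _ := by
          rw [hY, Nat.cast_mul, Nat.cast_pow, Real.mul_rpow (by positivity) (by positivity),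
            one_div, Real.pow_rpow_inv_natCast hXpos.le hd0]
          ring
  have hup : S ≤ (X : ℝ) ^ d * (A + 1 * (K₂ / X * E)) := by
    rw [← hsum, hS, hSeq]
    refine Finset.sum_le_sum fun m hm => Finset.sum_le_sum fun q hq => ?_
    rw [one_mul]
    exact mul_le_mul_of_nonneg_left (hterm m hm q hq).2 (Real.log_natCast_nonneg _)
  have hlow : (X : ℝ) ^ d * (A + (-1) * (K₂ / X * E)) ≤ S := by
    rw [← hsum, hS, hSeq]
    refine Finset.sum_le_sum fun m hm => Finset.sum_le_sum fun q hq => ?_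
    rw [neg_one_mul, ← sub_eq_add_neg]
    exact mul_le_mul_of_nonneg_left (hterm m hm q hq).1 (Real.log_natCast_nonneg _)
  have hXd' : 0 < (X : ℝ) ^ d := by positivity
  have h1 := le_of_mul_le_mul_left (hS1.trans hup) hXd'
  have h2 := le_of_mul_le_mul_left (hlow.trans hS2) hXd'
  have h3 := Real.log_natCast_nonneg K₁
  rw [abs_le]
  constructor <;> linarith

theorem exists_abs_sum_idealMangoldt_div_sub_log_le :
    ∃ K : ℝ, ∀ Y : ℕ, 1 ≤ Y →
      |∑ m ∈ Finset.Icc 1 Y, idealMangoldt (𝓞 F) m / m - Real.log Y| ≤ K := by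
  obtain ⟨K₁, K, hK₁, h⟩ := exists_abs_sum_idealMangoldt_div_sub_le F
  set d := Module.finrank ℚ F with hd
  have hd0 : d ≠ 0 := Module.finrank_pos.ne'
  set A : ℕ → ℝ := fun Y => ∑ m ∈ Finset.Icc 1 Y, idealMangoldt (𝓞 F) m / m with hA
  have hAmono : Monotone A := fun Y Z hYZ =>
    Finset.sum_le_sum_of_subset_of_nonneg (Finset.Icc_subset_Icc_right hYZ) fun m _ _ =>
      div_nonneg (idealMangoldt_nonneg m) (Nat.cast_nonneg m)
  have hK : 0 ≤ K := (abs_nonneg _).trans (h 1 le_rfl)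
  have hlog2 : 0 ≤ d * Real.log 2 := by positivity
  have hlogK₁ := Real.log_natCast_nonneg K₁
  have hK₁pos : (0 : ℝ) < K₁ := by positivity
  have hsucc (X : ℕ) (hX : 1 ≤ X) : Real.log ((X + 1 : ℕ) : ℝ) ≤ Real.log 2 + Real.log X := by
    rw [← Real.log_mul (by norm_num) (by positivity)]
    refine Real.log_le_log (by positivity) ?_
    have : (1 : ℝ) ≤ X := by exact_mod_cast hX
    push_cast
    linarith
  refine ⟨K + d * Real.log 2 + Real.log K₁ + Real.log 2, fun Y hY => ?_⟩
  have hl2 : 0 ≤ Real.log 2 := Real.log_nonneg (by norm_num)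
  have hYpos : (0 : ℝ) < Y := by positivity
  rw [abs_le]
  constructor
  · by_cases hYK : Y < K₁
    · have h1 : 0 ≤ A Y := Finset.sum_nonneg fun m _ =>
        div_nonneg (idealMangoldt_nonneg m) (Nat.cast_nonneg m)
      have h2 : Real.log Y ≤ Real.log K₁ := Real.log_le_log hYpos (by exact_mod_cast hYK.le)
      change _ ≤ A Y - _
      linarith
    · obtain ⟨X, hX1, hX2⟩ := exists_pow_le_lt d hd0 (Y / K₁)
      have hX : 1 ≤ X := by
        by_contra hX
        have hX0 : X = 0 := by omega
        rw [hX0, zero_add, one_pow, Nat.lt_one_iff, Nat.div_eq_zero_iff] at hX2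
        omega
      have h1 : A (K₁ * X ^ d) ≤ A Y := hAmono (by
        rw [mul_comm]
        exact (Nat.mul_le_mul_right _ hX1).trans (Nat.div_mul_le_self Y K₁))
      have h2 := (abs_le.1 (h X hX)).1
      have h3 : (Y : ℝ) ≤ K₁ * ((X + 1 : ℕ) : ℝ) ^ d := by
        have : Y < K₁ * (X + 1) ^ d :=
          (Nat.lt_mul_div_succ Y (by omega)).trans_le (Nat.mul_le_mul_left _ hX2)
        exact_mod_cast this.le
      have h4 := Real.log_le_log hYpos h3
      rw [Real.log_mul hK₁pos.ne' (by positivity), Real.log_pow] at h4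
      have h5 : d * Real.log ((X + 1 : ℕ) : ℝ) ≤ d * (Real.log 2 + Real.log X) := by
        gcongr
        exact hsucc X hX
      change _ ≤ A Y - _
      change _ ≤ A (K₁ * X ^ d) - _ at h2
      linarith
  · obtain ⟨X, hX1, hX2⟩ := exists_pow_le_lt d hd0 Y
    have hX : 1 ≤ X := by
      by_contra hX
      have hX0 : X = 0 := by omega
      rw [hX0, zero_add, one_pow] at hX2
      omega
    have h1 : A Y ≤ A (K₁ * (X + 1) ^ d) :=
      hAmono (hX2.le.trans (Nat.le_mul_of_pos_left _ (by omega)))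
    have h2 := (abs_le.1 (h (X + 1) (by omega))).2
    have h3 : (X : ℝ) ^ d ≤ Y := by exact_mod_cast hX1
    have h4 := Real.log_le_log (by positivity) h3
    rw [Real.log_pow] at h4
    have h5 : d * Real.log ((X + 1 : ℕ) : ℝ) ≤ d * (Real.log 2 + Real.log X) := by
      gcongr
      exact hsucc X hX
    change A Y - _ ≤ _
    change A (K₁ * (X + 1) ^ d) - _ ≤ _ at h2
    linarith

end Mertens

section Splitting

open NumberField Pointwise

theorem RingHom.eq_of_ker_eq_zmod {A : Type*} [CommRing A] {p : ℕ} [NeZero p]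
    {φ ψ : A →+* ZMod p} (h : RingHom.ker φ = RingHom.ker ψ) : φ = ψ := by
  ext x
  have hx : x - ((φ x).val : A) ∈ RingHom.ker φ := by
    simp [RingHom.mem_ker]
  rw [h, RingHom.mem_ker, map_sub, map_natCast, ZMod.natCast_zmod_val, sub_eq_zero] at hx
  exact hx.symm

theorem exists_ringHom_zmod_of_absNorm_eq {O : Type*} [CommRing O] [IsDedekindDomain O]
    [Module.Free ℤ O] [Module.Finite ℤ O] {p : ℕ} (hp : p.Prime) {P : Ideal O}
    (h : Ideal.absNorm P = p) : ∃ φ : O →+* ZMod p, RingHom.ker φ = P := by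
  have hcard : Nat.card (O ⧸ P) = p := by
    rw [← h, Ideal.absNorm_apply, Submodule.cardQuot_apply]
  have : Finite (O ⧸ P) := Nat.finite_of_card_ne_zero (by rw [hcard]; exact hp.ne_zero)
  have := Fintype.ofFinite (O ⧸ P)
  rw [Nat.card_eq_fintype_card] at hcard
  refine ⟨((ZMod.ringEquivOfPrime (O ⧸ P) hp hcard).symm : (O ⧸ P) →+* ZMod p).comp
    (Ideal.Quotient.mk P), ?_⟩
  ext x
  simp [RingHom.mem_ker, Ideal.Quotient.eq_zero_iff_mem]

theorem NumberField.RingOfIntegers.exists_smul_ne {F : Type*} [Field F] [NumberField F]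
    {σ τ : F ≃ₐ[ℚ] F} (h : σ ≠ τ) : ∃ x : 𝓞 F, σ • x ≠ τ • x := by
  by_contra! hx
  have hint : ∀ x : 𝓞 F, σ (x : F) = τ (x : F) := fun x => by
    have := congrArg (algebraMap (𝓞 F) F) (hx x)
    rwa [algebraMap.smul', algebraMap.smul'] at this
  refine h (AlgEquiv.ext fun z => ?_)
  obtain ⟨a, b, hb, rfl⟩ := IsFractionRing.div_surjective (A := 𝓞 F) z
  rw [map_div₀, map_div₀, hint, hint]

theorem exists_splitsCompletely_of_absNorm_eq (F : Type*) [Field F] [NumberField F]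
    [IsGalois ℚ F] : ∃ n : ℕ, n ≠ 0 ∧ ∀ p : ℕ, p.Prime → ¬ p ∣ n →
      (∃ P : Ideal (𝓞 F), P.IsPrime ∧ Ideal.absNorm P = p) → SplitsCompletely F p := by
  classical
  choose! x hx using fun q : (F ≃ₐ[ℚ] F) × (F ≃ₐ[ℚ] F) =>
    fun h : q.1 ≠ q.2 => RingOfIntegers.exists_smul_ne h
  set S := Finset.univ.filter fun q : (F ≃ₐ[ℚ] F) × (F ≃ₐ[ℚ] F) => q.1 ≠ q.2 with hS
  set δ : 𝓞 F := ∏ q ∈ S, (q.1 • x q - q.2 • x q) with hδ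
  have hδ0 : δ ≠ 0 := Finset.prod_ne_zero_iff.2 fun q hq =>
    sub_ne_zero.2 (hx q (Finset.mem_filter.1 hq).2)
  refine ⟨Ideal.absNorm (Ideal.span {δ}), by simpa using hδ0, ?_⟩
  rintro p hp hpn ⟨P, hP, hPp⟩
  have : Fact p.Prime := ⟨hp⟩
  obtain ⟨φ, hφ⟩ := exists_ringHom_zmod_of_absNorm_eq hp hPp
  have hφδ : φ δ ≠ 0 := fun h0 => hpn (hPp ▸ Ideal.absNorm_dvd_absNorm_of_le
    ((Ideal.span_singleton_le_iff_mem _).2 (hφ ▸ h0)))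
  have hbij : Function.Bijective fun σ : F ≃ₐ[ℚ] F =>
      φ.comp (MulSemiringAction.toRingHom (F ≃ₐ[ℚ] F) (𝓞 F) σ) := by
    constructor
    · intro σ τ h
      by_contra hne
      refine hφδ ?_
      rw [hδ, map_prod]
      refine Finset.prod_eq_zero (i := (σ, τ)) (by simp [hS, hne]) ?_
      rw [map_sub, sub_eq_zero]
      exact congrArg (fun f : 𝓞 F →+* ZMod p => f (x (σ, τ))) h
    · intro ψ
      have := RingHom.ker_isPrime ψ
      obtain ⟨g, hg⟩ := Algebra.IsInvariant.exists_smul_of_under_eq ℤ (𝓞 F) (F ≃ₐ[ℚ] F) P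
        (RingHom.ker ψ) (by
          rw [← hφ]
          ext n
          simp [Ideal.mem_comap, RingHom.mem_ker])
      refine ⟨g⁻¹, RingHom.eq_of_ker_eq_zmod ?_⟩
      rw [hg]
      ext y
      rw [Ideal.mem_pointwise_smul_iff_inv_smul_mem, ← hφ]
      rfl
  have := Nat.card_congr (Equiv.ofBijective _ hbij)
  rw [IsGalois.card_aut_eq_finrank] at this
  exact this.symm

theorem sum_log_primeFactors_le (s : Finset ℕ) {b : ℕ} (hb : b ≠ 0) :
    ∑ m ∈ s, (if m ∈ b.primeFactors then Real.log m else 0) ≤ Real.log b := by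
  rw [← Finset.sum_filter]
  calc ∑ m ∈ s with m ∈ b.primeFactors, Real.log m
      ≤ ∑ m ∈ b.primeFactors, Real.log m :=
        Finset.sum_le_sum_of_subset_of_nonneg (fun m hm => (Finset.mem_filter.1 hm).2)
          fun m _ _ => Real.log_natCast_nonneg m
    _ = Real.log (∏ m ∈ b.primeFactors, m : ℕ) := by
        rw [Nat.cast_prod, Real.log_prod]
        intro m hm
        exact_mod_cast (Nat.prime_of_mem_primeFactors hm).ne_zero
    _ ≤ Real.log b := by
        refine Real.log_le_log ?_ ?_
        · exact_mod_cast Finset.prod_pos fun m hm => (Nat.prime_of_mem_primeFactors hm).pos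
        · exact_mod_cast Nat.le_of_dvd (Nat.pos_of_ne_zero hb) (Nat.prod_primeFactors_dvd b)

theorem exists_prime_splitsCompletely_not_dvd (F : Type*) [Field F] [NumberField F]
    [IsGalois ℚ F] {c : ℝ} (hc : 1 ≤ c) : ∃ C : ℝ, 1 ≤ C ∧ ∀ n : ℝ, 2 ≤ n →
      ∀ b : ℕ, b ≠ 0 → (b : ℝ) ≤ c ^ n →
        ∃ p : ℕ, p.Prime ∧ n ≤ p ∧ (p : ℝ) ≤ C * n ∧ SplitsCompletely F p ∧ ¬ p ∣ b := by
  obtain ⟨K, hK⟩ := exists_abs_sum_idealMangoldt_div_sub_log_le F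
  obtain ⟨n₀, hn₀, hsplit⟩ := exists_splitsCompletely_of_absNorm_eq F
  set d : ℝ := (Module.finrank ℤ (𝓞 F) : ℝ) with hd
  have hd0 : 0 ≤ d := Nat.cast_nonneg _
  set T : ℝ := ∑' n : ℕ, (if n.Prime then 0 else ArithmeticFunction.vonMangoldt n) / (n : ℝ)
    with hT
  have hf0 : ∀ n : ℕ, 0 ≤ (if n.Prime then 0 else ArithmeticFunction.vonMangoldt n) / (n : ℝ) := by
    intro n
    have := ArithmeticFunction.vonMangoldt_nonneg (n := n)
    split_ifs <;> positivity
  have hT0 : 0 ≤ T := tsum_nonneg hf0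
  have hK0 : 0 ≤ K := (abs_nonneg _).trans (hK 1 le_rfl)
  have hn₀' : 0 ≤ Real.log n₀ := Real.log_natCast_nonneg _
  have hc' : 0 ≤ Real.log c := Real.log_nonneg hc
  have hl2 : 0 < Real.log 2 := Real.log_pos one_lt_two
  set M : ℝ := 2 * K + d * (T + Real.log n₀ + Real.log c) + 2 * Real.log 2 with hM
  have hC1 : 1 ≤ Real.exp M := Real.one_le_exp (by positivity)
  refine ⟨Real.exp M, hC1, fun n hn b hb hbn => ?_⟩
  by_contra! hcon
  have hn0 : 0 < n := by linarith
  have hCn : n ≤ Real.exp M * n := le_mul_of_one_le_left hn0.le hC1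
  set X := ⌊n⌋₊
  set Y := ⌊Real.exp M * n⌋₊
  have hXY : X ≤ Y := Nat.floor_le_floor hCn
  have hX1 : 1 ≤ X := Nat.one_le_floor_iff _ |>.2 (by linarith)
  have hdiff : ∑ m ∈ Finset.Icc 1 Y, idealMangoldt (𝓞 F) m / m =
      ∑ m ∈ Finset.Icc 1 X, idealMangoldt (𝓞 F) m / m +
        ∑ m ∈ Finset.Ioc X Y, idealMangoldt (𝓞 F) m / m := by
    rw [← Finset.sum_union]
    · congr 1
      ext m
      simp only [Finset.mem_Icc, Finset.mem_union, Finset.mem_Ioc]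
      omega
    · rw [Finset.disjoint_left]
      intro m
      simp only [Finset.mem_Icc, Finset.mem_Ioc]
      omega
  have hXlog : Real.log X ≤ Real.log n :=
    Real.log_le_log (by exact_mod_cast hX1) (Nat.floor_le hn0.le)
  have hYlog : M + Real.log n - Real.log 2 ≤ Real.log Y := by
    have : Real.log (Real.exp M * n / 2) = M + Real.log n - Real.log 2 := by
      rw [Real.log_div (by positivity) (by norm_num), Real.log_mul (by positivity) (by positivity),
        Real.log_exp]
    rw [← this]
    refine Real.log_le_log (by positivity) ?_
    have := Nat.lt_floor_add_one (Real.exp M * n)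
    change _ < (Y : ℝ) + 1 at this
    linarith
  have hupper : ∑ m ∈ Finset.Ioc X Y, idealMangoldt (𝓞 F) m / m ≤
      d * (T + Real.log n₀ + Real.log c) := by
    have hterm : ∀ m ∈ Finset.Ioc X Y, idealMangoldt (𝓞 F) m / m ≤
        d * ((if m.Prime then 0 else ArithmeticFunction.vonMangoldt m) / (m : ℝ) +
          (if m ∈ n₀.primeFactors then Real.log m else 0) +
          (if m ∈ b.primeFactors then Real.log m else 0) / n) := by
      intro m hm
      rw [Finset.mem_Ioc] at hm
      have hnm : n < m := (Nat.floor_lt hn0.le).1 hm.1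
      have hmC : (m : ℝ) ≤ Real.exp M * n := (Nat.le_floor_iff (by positivity)).1 hm.2
      have hm0 : (0 : ℝ) < m := hn0.trans hnm
      have hlm : 0 ≤ Real.log m := Real.log_natCast_nonneg m
      have h1 : 0 ≤ if m ∈ n₀.primeFactors then Real.log m else 0 := by split_ifs <;> simp [hlm]
      have h2 : 0 ≤ (if m ∈ b.primeFactors then Real.log m else 0) / n := by
        split_ifs <;> positivity
      have hle := idealMangoldt_le (O := 𝓞 F) m
      rw [← hd] at hle
      have hdiv : idealMangoldt (𝓞 F) m / m ≤ d * (ArithmeticFunction.vonMangoldt m / m) := by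
        rw [← mul_div_assoc]
        gcongr
      by_cases hmp : m.Prime
      · rw [if_pos hmp, zero_div, zero_add]
        rw [ArithmeticFunction.vonMangoldt_apply_prime hmp] at hdiv
        by_cases hz : idealMangoldt (𝓞 F) m = 0
        · rw [hz, zero_div]
          positivity
        · refine hdiv.trans (mul_le_mul_of_nonneg_left ?_ hd0)
          by_cases hmn : m ∣ n₀
          · rw [if_pos (Nat.mem_primeFactors.2 ⟨hmp, hmn, hn₀⟩)]
            have : Real.log m / m ≤ Real.log m := div_le_self hlm (by linarith)
            linarith
          · have hs := hsplit m hmp hmn (exists_absNorm_eq_of_idealMangoldt_ne_zero hmp hz)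
            rw [if_pos (Nat.mem_primeFactors.2 ⟨hmp, hcon m hmp hnm.le hmC hs, hb⟩)]
            have : Real.log m / m ≤ Real.log m / n := by gcongr
            linarith
      · rw [if_neg hmp]
        refine hdiv.trans (mul_le_mul_of_nonneg_left ?_ hd0)
        linarith
    refine (Finset.sum_le_sum hterm).trans ?_
    rw [← Finset.mul_sum, Finset.sum_add_distrib, Finset.sum_add_distrib, ← Finset.sum_div]
    refine mul_le_mul_of_nonneg_left (add_le_add (add_le_add ?_ ?_) ?_) hd0
    · exact summable_vonMangoldt_not_prime_div.sum_le_tsum _ fun i _ => hf0 i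
    · exact sum_log_primeFactors_le _ hn₀
    · rw [div_le_iff₀ hn0]
      refine (sum_log_primeFactors_le _ hb).trans ?_
      rw [mul_comm, ← Real.log_rpow (by linarith)]
      exact Real.log_le_log (by exact_mod_cast Nat.pos_of_ne_zero hb) hbn
  have hKX := abs_le.1 (hK X hX1)
  have hKY := abs_le.1 (hK Y (hX1.trans hXY))
  linarith [hKX.2, hKY.1]

end Splitting

section PolynomialHeight

open MvPolynomial

variable {σ : Type*} {N : ℕ}

/-- `P` bounds the coefficients of `G` from above in absolute value. -/
def CoeffDominates (P G : MvPolynomial σ ℤ) : Prop := ∀ m, |coeff m G| ≤ coeff m P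

namespace CoeffDominates

variable {P G P' G' : MvPolynomial σ ℤ}

theorem add (h : CoeffDominates P G) (h' : CoeffDominates P' G') :
    CoeffDominates (P + P') (G + G') := fun m => by
  rw [coeff_add, coeff_add]
  exact (abs_add_le _ _).trans (add_le_add (h m) (h' m))

theorem sum {ι : Type*} {s : Finset ι} {P G : ι → MvPolynomial σ ℤ}
    (h : ∀ i ∈ s, CoeffDominates (P i) (G i)) :
    CoeffDominates (∑ i ∈ s, P i) (∑ i ∈ s, G i) := fun m => by
  rw [coeff_sum, coeff_sum]
  exact (Finset.abs_sum_le_sum_abs _ _).trans (Finset.sum_le_sum fun i hi => h i hi m)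

theorem mul (h : CoeffDominates P G) (h' : CoeffDominates P' G') :
    CoeffDominates (P * P') (G * G') := fun m => by
  classical
  rw [coeff_mul, coeff_mul]
  refine (Finset.abs_sum_le_sum_abs _ _).trans (Finset.sum_le_sum fun i _ => ?_)
  rw [abs_mul]
  exact mul_le_mul (h _) (h' _) (abs_nonneg _) ((abs_nonneg _).trans (h _))

theorem C (a : ℤ) : CoeffDominates (C |a| : MvPolynomial σ ℤ) (C a) := fun m => by
  classical
  rw [coeff_C, coeff_C]
  split_ifs <;> simp

theorem X (i : σ) : CoeffDominates (X i : MvPolynomial σ ℤ) (X i) := fun m => by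
  classical
  rw [coeff_X]
  split_ifs <;> simp

theorem abs_coeff_le (h : CoeffDominates P G) (m : σ →₀ ℕ) : |coeff m G| ≤ eval 1 P := by
  have hP : ∀ m, 0 ≤ coeff m P := fun m => (abs_nonneg _).trans (h m)
  rw [eval_eq]
  simp only [Pi.one_apply, one_pow, Finset.prod_const_one, mul_one]
  refine (h m).trans ?_
  by_cases hm : m ∈ P.support
  · exact Finset.single_le_sum (f := fun d => coeff d P) (fun d _ => hP d) hm
  · rw [notMem_support_iff.1 hm]
    exact Finset.sum_nonneg fun d _ => hP d

end CoeffDominates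

/-- `f` has logarithmic height (to base `N`) at most `H`: it can be written as `N ^ (-E) * G`
with `E ≤ H`, where `G` has integer coefficients whose absolute values have sum at most
`N ^ (E + H)`. -/
def HeightLE (f : MvPolynomial σ (ZInv N)) (H : ℝ) : Prop :=
  ∃ (E : ℕ) (G P : MvPolynomial σ ℤ), (E : ℝ) ≤ H ∧
    (N : MvPolynomial σ (ZInv N)) ^ E * f = map (algebraMap ℤ (ZInv N)) G ∧
    CoeffDominates P G ∧ ((eval 1 P : ℤ) : ℝ) ≤ (N : ℝ) ^ (E + H)

namespace HeightLE

variable {f g : MvPolynomial σ (ZInv N)} {H H' : ℝ}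

theorem nonneg (h : HeightLE f H) : 0 ≤ H := by
  obtain ⟨E, G, P, hE, -⟩ := h
  exact (Nat.cast_nonneg E).trans hE

theorem mono (hN : 2 ≤ N) (h : HeightLE f H) (hH : H ≤ H') : HeightLE f H' := by
  obtain ⟨E, G, P, hE, hG, hP, hle⟩ := h
  refine ⟨E, G, P, hE.trans hH, hG, hP, hle.trans ?_⟩
  have : (1 : ℝ) ≤ N := by exact_mod_cast (by omega : 1 ≤ N)
  gcongr

theorem sum (hN : 2 ≤ N) {ι : Type*} [Fintype ι] [Nonempty ι]
    {f : ι → MvPolynomial σ (ZInv N)} (h : ∀ i, HeightLE (f i) H) :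
    HeightLE (∑ i, f i) (Real.logb N (Fintype.card ι) + H) := by
  choose E G P hE hG hP hle using h
  have hN0 : (0 : ℝ) < N := by exact_mod_cast (by omega : 0 < N)
  have hN1 : (1 : ℝ) < N := by exact_mod_cast (by omega : 1 < N)
  have hm1 : (1 : ℝ) ≤ Fintype.card ι := by exact_mod_cast Fintype.card_pos
  have hEle : ∀ i, E i ≤ Finset.univ.sup E := fun i => Finset.le_sup (Finset.mem_univ i)
  have hlog : 0 ≤ Real.logb N (Fintype.card ι) := Real.logb_nonneg hN1 hm1
  have hsup : ((Finset.univ.sup E : ℕ) : ℝ) ≤ H := by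
    obtain ⟨i, -, hi⟩ := Finset.exists_mem_eq_sup Finset.univ Finset.univ_nonempty E
    rw [hi]
    exact hE i
  refine ⟨Finset.univ.sup E, ∑ i, C ((N : ℤ) ^ (Finset.univ.sup E - E i)) * G i,
    ∑ i, C |(N : ℤ) ^ (Finset.univ.sup E - E i)| * P i, by linarith, ?_,
    CoeffDominates.sum fun i _ => (CoeffDominates.C _).mul (hP i), ?_⟩
  · rw [Finset.mul_sum, map_sum]
    refine Finset.sum_congr rfl fun i _ => ?_
    rw [map_mul, map_C, ← hG, ← mul_assoc]
    congr 1
    simp only [map_pow, map_natCast]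
    rw [← pow_add, Nat.sub_add_cancel (hEle i)]
  · rw [map_sum, Int.cast_sum, add_left_comm, Real.rpow_add hN0,
      Real.rpow_logb hN0 hN1.ne' (by linarith)]
    refine (Finset.sum_le_card_nsmul _ _ ((N : ℝ) ^ ((Finset.univ.sup E : ℕ) + H))
      fun i _ => ?_).trans_eq (by simp)
    rw [map_mul, eval_C, abs_of_nonneg (by positivity)]
    push_cast
    calc (N : ℝ) ^ (Finset.univ.sup E - E i) * (eval 1 (P i) : ℤ)
        ≤ (N : ℝ) ^ (Finset.univ.sup E - E i) * (N : ℝ) ^ (E i + H) := by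
          gcongr
          exact hle i
      _ = (N : ℝ) ^ (((Finset.univ.sup E : ℕ) : ℝ) + H) := by
          rw [← Real.rpow_natCast, ← Real.rpow_add hN0, Nat.cast_sub (hEle i)]
          congr 1
          ring

theorem add (hN : 2 ≤ N) (hf : HeightLE f H) (hg : HeightLE g H) :
    HeightLE (f + g) (1 + H) := by
  have := sum hN (f := ![f, g]) (H := H) (by simp [Fin.forall_fin_two, hf, hg])
  rw [Fin.sum_univ_two, Fintype.card_fin] at this
  refine this.mono hN (add_le_add_left ?_ H)
  rw [Real.logb_le_iff_le_rpow (by exact_mod_cast (by omega : 1 < N)) (by norm_num),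
    Real.rpow_one]
  exact_mod_cast hN

theorem mul (hN : 2 ≤ N) (hf : HeightLE f H) (hg : HeightLE g H') :
    HeightLE (f * g) (H + H') := by
  obtain ⟨E, G, P, hE, hG, hP, hle⟩ := hf
  obtain ⟨E', G', P', hE', hG', hP', hle'⟩ := hg
  have hN0 : (0 : ℝ) < N := by exact_mod_cast (by omega : 0 < N)
  refine ⟨E + E', G * G', P * P', by push_cast; linarith, ?_, hP.mul hP', ?_⟩
  · rw [map_mul, ← hG, ← hG', pow_add]
    ring
  · rw [map_mul, Int.cast_mul, Nat.cast_add, add_add_add_comm, Real.rpow_add hN0]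
    refine mul_le_mul hle hle' ?_ (by positivity)
    exact_mod_cast (abs_nonneg _).trans (hP'.abs_coeff_le 0)

theorem X (i : σ) : HeightLE (X i : MvPolynomial σ (ZInv N)) 0 :=
  ⟨0, MvPolynomial.X i, MvPolynomial.X i, by simp, by simp, CoeffDominates.X i, by simp⟩

theorem exists_C (hN : 2 ≤ N) (a : ZInv N) :
    ∃ H, HeightLE (C a : MvPolynomial σ (ZInv N)) H := by
  obtain ⟨E, z, hz⟩ := IsLocalization.Away.surj (N : ℤ) a
  have hN1 : (1 : ℝ) < N := by exact_mod_cast (by omega : 1 < N)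
  obtain ⟨k, hk⟩ := pow_unbounded_of_one_lt (|z| : ℝ) hN1
  refine ⟨max E k, E, C z, C |z|, le_max_left _ _, ?_, CoeffDominates.C z, ?_⟩
  · rw [map_C, ← hz]
    simp [mul_comm]
  · rw [eval_C]
    push_cast
    refine hk.le.trans ?_
    rw [← Real.rpow_natCast]
    refine Real.rpow_le_rpow_of_exponent_le hN1.le ?_
    have := le_max_right (E : ℝ) k
    have := Nat.cast_nonneg (α := ℝ) E
    linarith

theorem exists_of_polynomial (hN : 2 ≤ N) (f : MvPolynomial σ (ZInv N)) : ∃ H, HeightLE f H := by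
  induction f using MvPolynomial.induction_on with
  | C a => exact exists_C hN a
  | add f g hf hg =>
    obtain ⟨H, hf⟩ := hf
    obtain ⟨H', hg⟩ := hg
    exact ⟨_, (hf.mono hN (le_max_left H H')).add hN (hg.mono hN (le_max_right H H'))⟩
  | mul_X f i hf =>
    obtain ⟨H, hf⟩ := hf
    exact ⟨_, hf.mul hN (X i)⟩

theorem exists_forall {ι : Type*} [Finite ι] (hN : 2 ≤ N) (f : ι → MvPolynomial σ (ZInv N)) :
    ∃ H, 0 ≤ H ∧ ∀ i, HeightLE (f i) H := by
  choose H hH using fun i => HeightLE.exists_of_polynomial hN (f i)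
  obtain ⟨B, hB⟩ := (Set.finite_range H).bddAbove
  exact ⟨max B 0, le_max_right _ _, fun i =>
    (hH i).mono hN ((hB ⟨i, rfl⟩).trans (le_max_left _ _))⟩

theorem exists_aeval (hN : 2 ≤ N) {τ : Type*} (Q : MvPolynomial τ ℤ) :
    ∃ K D : ℝ, 0 ≤ K ∧ 0 ≤ D ∧ ∀ (f : τ → MvPolynomial σ (ZInv N)) (H : ℝ),
      0 ≤ H → (∀ i, HeightLE (f i) H) → HeightLE (aeval f Q) (K + D * H) := by
  induction Q using MvPolynomial.induction_on with
  | C a =>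
    obtain ⟨K, hK⟩ := exists_C (σ := σ) hN (a : ZInv N)
    refine ⟨K, 0, hK.nonneg, le_rfl, fun f H _ _ => ?_⟩
    simpa using hK
  | add P Q hP hQ =>
    obtain ⟨K, D, hK, hD, h⟩ := hP
    obtain ⟨K', D', hK', hD', h'⟩ := hQ
    refine ⟨1 + (K + K'), D + D', by positivity, by positivity, fun f H hH hf => ?_⟩
    rw [map_add, add_assoc]
    refine ((h f H hH hf).mono hN ?_).add hN ((h' f H hH hf).mono hN ?_)
    · nlinarith
    · nlinarith
  | mul_X Q i hQ =>
    obtain ⟨K, D, hK, hD, h⟩ := hQ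
    refine ⟨K, D + 1, hK, by positivity, fun f H hH hf => ?_⟩
    rw [map_mul, aeval_X, add_mul, one_mul, ← add_assoc]
    exact (h f H hH hf).mul hN (hf i)

end HeightLE

end PolynomialHeight

section Algebra

theorem Module.exists_linearMap_pi_injective (A M : Type*) [CommRing A] [IsDomain A]
    [AddCommGroup M] [Module A M] [Module.IsTorsionFree A M] [Module.Finite A M] :
    ∃ (ι : Type) (φ : M →ₗ[A] (ι → A)), Finite ι ∧ Function.Injective φ := by
  classical
  obtain ⟨n, y, hy⟩ := Module.Finite.exists_fin (R := A) (M := M)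
  obtain ⟨I, hI, hmax⟩ := exists_maximal_linearIndepOn A y
  have ha : ∀ i, ∃ a : A, a ≠ 0 ∧ a • y i ∈ Submodule.span A (y '' I) := fun i => by
    by_cases hi : i ∈ I
    · exact ⟨1, one_ne_zero, by
        rw [one_smul]
        exact Submodule.subset_span ⟨i, hi, rfl⟩⟩
    · exact hmax i hi
  choose a ha0 ha using ha
  have hmem : ∀ x : M, LinearMap.lsmul A M (∏ i, a i) x ∈ Submodule.span A (y '' I) := fun x => by
    have hx : x ∈ Submodule.span A (Set.range y) := hy ▸ Submodule.mem_top
    induction hx using Submodule.span_induction with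
    | mem x hx =>
      obtain ⟨i, rfl⟩ := hx
      rw [LinearMap.lsmul_apply, ← Finset.prod_erase_mul _ _ (Finset.mem_univ i), mul_smul]
      exact Submodule.smul_mem _ _ (ha i)
    | zero => simp
    | add x z _ _ hx hz =>
      rw [map_add]
      exact Submodule.add_mem _ hx hz
    | smul c x _ hx =>
      rw [map_smul]
      exact Submodule.smul_mem _ _ hx
  have hli : LinearIndependent A fun i : I => y i := hI
  have hrange : Set.range (fun i : I => y i) = y '' I := by
    ext
    simp
  rw [← hrange] at hmem
  refine ⟨I, (Module.Basis.span hli).equivFun.toLinearMap ∘ₗ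
    (LinearMap.lsmul A M (∏ i, a i)).codRestrict _ hmem, inferInstance, ?_⟩
  rw [LinearMap.coe_comp]
  refine (LinearEquiv.injective _).comp fun x z h => ?_
  exact smul_right_injective M (Finset.prod_ne_zero_iff.2 fun i _ => ha0 i)
    (congrArg Subtype.val h)

theorem Module.exists_nat_forall_prime_torsion (A M : Type*) [CommRing A] [IsNoetherianRing A]
    [AddCommGroup M] [Module A M] [Module.Finite A M] :
    ∃ n : ℕ, n ≠ 0 ∧ ∀ p : ℕ, p.Prime → ¬ p ∣ n → ∀ x : M, p • x = 0 → x = 0 := by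
  classical
  let T : Submodule A M :=
    { carrier := {x | ∃ n : ℕ, n ≠ 0 ∧ n • x = 0}
      add_mem' := by
        rintro x y ⟨n, hn, hx⟩ ⟨m, hm, hy⟩
        refine ⟨m * n, mul_ne_zero hm hn, ?_⟩
        rw [smul_add, mul_smul, hx, mul_comm, mul_smul, hy, smul_zero, smul_zero, add_zero]
      zero_mem' := ⟨1, one_ne_zero, smul_zero _⟩
      smul_mem' := by
        rintro c x ⟨n, hn, hx⟩
        exact ⟨n, hn, by rw [smul_comm, hx, smul_zero]⟩ }
  obtain ⟨S, hS⟩ := IsNoetherian.noetherian T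
  have hST : ∀ x ∈ S, ∃ n : ℕ, n ≠ 0 ∧ n • x = 0 := fun x hx =>
    show x ∈ T from hS ▸ Submodule.subset_span hx
  choose! n hn hnx using hST
  have hT : ∀ x ∈ T, (∏ s ∈ S, n s) • x = 0 := by
    intro x hx
    rw [← hS] at hx
    induction hx using Submodule.span_induction with
    | mem x hx => rw [← Finset.prod_erase_mul _ _ hx, mul_smul, hnx x hx, smul_zero]
    | zero => simp
    | add x z _ _ hx hz => rw [smul_add, hx, hz, add_zero]
    | smul c x _ hx => rw [smul_comm, hx, smul_zero]
  refine ⟨∏ s ∈ S, n s, Finset.prod_ne_zero_iff.2 hn, fun p hp hpn x hx => ?_⟩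
  have hcop : IsCoprime (p : ℤ) ((∏ s ∈ S, n s : ℕ) : ℤ) :=
    Nat.isCoprime_iff_coprime.2 ((Nat.Prime.coprime_iff_not_dvd hp).2 hpn)
  obtain ⟨u, v, huv⟩ := hcop
  have h1 := hT x ⟨p, hp.ne_zero, hx⟩
  rw [← one_smul ℤ x, ← huv, add_smul, mul_smul, mul_smul, natCast_zsmul, natCast_zsmul, hx, h1]
  simp

theorem Module.exists_linearMap_pi_forall_prime (A M : Type*) [CommRing A] [IsDomain A]
    [IsNoetherianRing A] [AddCommGroup M] [Module A M] [Module.IsTorsionFree A M]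
    [Module.Finite A M] :
    ∃ (ι : Type) (φ : M →ₗ[A] (ι → A)) (n : ℕ), n ≠ 0 ∧ Function.Injective φ ∧
      ∀ p : ℕ, p.Prime → ¬ p ∣ n → ∀ (x : M) (w : ι → A), φ x = p • w → ∃ y, x = p • y := by
  obtain ⟨ι, φ, hι, hφ⟩ := Module.exists_linearMap_pi_injective A M
  obtain ⟨n, hn, h⟩ :=
    Module.exists_nat_forall_prime_torsion A ((ι → A) ⧸ LinearMap.range φ)
  refine ⟨ι, φ, n, hn, hφ, fun p hp hpn x w hxw => ?_⟩
  have hw := h p hp hpn (Submodule.Quotient.mk w) (by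
    rw [← Submodule.Quotient.mk_smul, Submodule.Quotient.mk_eq_zero, ← hxw]
    exact ⟨x, rfl⟩)
  obtain ⟨y, rfl⟩ := (Submodule.Quotient.mk_eq_zero _).1 hw
  exact ⟨y, hφ (by rw [hxw, map_nsmul])⟩

theorem Matrix.aeval_charpoly_of_forall_mul_eq {A R : Type*} [CommRing A] [CommRing R]
    [IsDomain R] [Algebra A R] {n : Type*} [Fintype n] [DecidableEq n] (M : Matrix n n A)
    (r : R) {y : n → R} (hy : y ≠ 0) (h : ∀ i, r * y i = ∑ j, algebraMap A R (M i j) * y j) :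
    Polynomial.aeval r M.charpoly = 0 := by
  rw [Polynomial.aeval_def, Polynomial.eval₂_eq_eval_map, ← Matrix.charpoly_map,
    Matrix.eval_charpoly, ← Matrix.exists_mulVec_eq_zero_iff]
  refine ⟨y, hy, ?_⟩
  ext i
  rw [Matrix.sub_mulVec, Pi.sub_apply, Matrix.scalar_apply, Matrix.mulVec_diagonal, h]
  simp [Matrix.mulVec, dotProduct]

theorem tmul_one_mem_nonZeroDivisors {R : Type*} [CommRing R] {p : ℕ} {r : R}
    (h : ∀ x z : R, r * x = p * z → ∃ y, x = p * y) :
    (r ⊗ₜ[ℤ] (1 : ZMod p)) ∈ nonZeroDivisors (R ⊗[ℤ] ZMod p) := by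
  have hsurj : ∀ w : R ⊗[ℤ] ZMod p, ∃ x : R, w = x ⊗ₜ[ℤ] (1 : ZMod p) := by
    intro w
    induction w using TensorProduct.induction_on with
    | zero => exact ⟨0, (TensorProduct.zero_tmul _ _).symm⟩
    | tmul x a =>
      obtain ⟨k, rfl⟩ := ZMod.intCast_surjective a
      refine ⟨k • x, ?_⟩
      rw [TensorProduct.smul_tmul, zsmul_one]
    | add u v hu hv =>
      obtain ⟨x, rfl⟩ := hu
      obtain ⟨y, rfl⟩ := hv
      exact ⟨x + y, (TensorProduct.add_tmul _ _ _).symm⟩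
  have hzero : ∀ x : R, x ⊗ₜ[ℤ] (1 : ZMod p) = 0 → ∃ z, x = p * z := by
    intro x hx
    have hexact : Function.Exact (LinearMap.lsmul ℤ ℤ p)
        (Int.castAddHom (ZMod p)).toIntLinearMap := by
      intro k
      simp only [AddMonoidHom.coe_toIntLinearMap, Int.coe_castAddHom,
        ZMod.intCast_zmod_eq_zero_iff_dvd, Set.mem_range, LinearMap.lsmul_apply,
        smul_eq_mul, dvd_def]
      exact exists_congr fun c => eq_comm
    have := lTensor_exact R hexact (fun a => ZMod.intCast_surjective a) (x ⊗ₜ[ℤ] (1 : ℤ))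
    rw [LinearMap.lTensor_tmul] at this
    obtain ⟨w, hw⟩ := this.1 (by simpa using hx)
    obtain ⟨z, rfl⟩ := (TensorProduct.rid ℤ R).symm.surjective w
    refine ⟨z, ?_⟩
    have := congrArg (TensorProduct.rid ℤ R) hw
    simpa using this.symm
  rw [mem_nonZeroDivisors_iff_right]
  intro w hw
  obtain ⟨x, rfl⟩ := hsurj w
  rw [Algebra.TensorProduct.tmul_mul_tmul, mul_one] at hw
  obtain ⟨z, hz⟩ := hzero _ hw
  obtain ⟨y, rfl⟩ := h x z (by rw [← hz, mul_comm])
  rw [← nsmul_eq_mul, ← TensorProduct.smul_tmul', ← TensorProduct.tmul_smul]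
  simp

end Algebra

section PolynomialHeight

open MvPolynomial

variable {σ : Type*} {N : ℕ}

theorem ZInv.powers_le_nonZeroDivisors (hN : 2 ≤ N) :
    Submonoid.powers (N : ℤ) ≤ nonZeroDivisors ℤ :=
  powers_le_nonZeroDivisors_of_noZeroDivisors (Int.natCast_ne_zero.2 (by omega))

theorem ZInv.isDomain (hN : 2 ≤ N) : IsDomain (ZInv N) :=
  IsLocalization.isDomain_localization (ZInv.powers_le_nonZeroDivisors hN)

theorem ZInv.algebraMap_injective (hN : 2 ≤ N) : Function.Injective (algebraMap ℤ (ZInv N)) :=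
  IsLocalization.injective _ (ZInv.powers_le_nonZeroDivisors hN)

theorem ZInv.prime_natCast (hN : 2 ≤ N) {p : ℕ} (hp : p.Prime) (hpN : ¬ p ∣ N) :
    Prime (p : ZInv N) := by
  have hp' : Prime (p : ℤ) := Nat.prime_iff_prime_int.1 hp
  have hI : (Ideal.span {(p : ℤ)}).IsPrime := (Ideal.span_singleton_prime hp'.ne_zero).2 hp'
  have h := IsLocalization.isPrime_of_isPrime_disjoint (Submonoid.powers (N : ℤ)) (ZInv N)
    (Ideal.span {(p : ℤ)}) hI (by
      rw [Ideal.disjoint_powers_iff_notMem_of_isPrime, Ideal.mem_span_singleton]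
      exact_mod_cast hpN)
  rw [Ideal.map_span, Set.image_singleton, map_natCast] at h
  refine (Ideal.span_singleton_prime ?_).1 h
  rw [← map_natCast (algebraMap ℤ (ZInv N)), Ne, map_eq_zero_iff _ (ZInv.algebraMap_injective hN)]
  exact hp'.ne_zero

theorem ZInv.isUnit_natCast {p : ℕ} (hpN : p ∣ N) : IsUnit (p : ZInv N) := by
  have h := IsLocalization.Away.algebraMap_isUnit (S := ZInv N) (N : ℤ)
  rw [map_natCast] at h
  exact isUnit_of_dvd_unit (Nat.cast_dvd_cast hpN) h

theorem ZInv.dvd_of_natCast_dvd_intCast (hN : 2 ≤ N) {p : ℕ} (hp : p.Prime) (hpN : ¬ p ∣ N)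
    {z : ℤ} (h : (p : ZInv N) ∣ algebraMap ℤ (ZInv N) z) : (p : ℤ) ∣ z := by
  obtain ⟨a, ha⟩ := h
  obtain ⟨E, w, hw⟩ := IsLocalization.Away.surj (N : ℤ) a
  have hz : z * (N : ℤ) ^ E = p * w := by
    refine ZInv.algebraMap_injective hN ?_
    rw [map_mul, ha, map_mul, ← hw, map_pow, map_natCast, map_natCast]
    ring
  have hp' : Prime (p : ℤ) := Nat.prime_iff_prime_int.1 hp
  refine (hp'.dvd_or_dvd ⟨w, hz⟩).resolve_right fun h => hpN ?_
  exact_mod_cast hp'.dvd_of_dvd_pow h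

theorem HeightLE.exists_nat_forall_prime_dvd (hN : 2 ≤ N) {g : MvPolynomial σ (ZInv N)} {H : ℝ}
    (h : HeightLE g H) (hg : g ≠ 0) :
    ∃ b : ℕ, b ≠ 0 ∧ (b : ℝ) ≤ (N : ℝ) ^ (2 * H) ∧ ∀ p : ℕ, p.Prime → ¬ p ∣ b →
      ∀ x z : MvPolynomial σ (ZInv N), g * x = p * z → (p : MvPolynomial σ (ZInv N)) ∣ x := by
  have := ZInv.isDomain hN
  obtain ⟨E, G, P, hE, hG, hP, hle⟩ := h
  have hN1 : (1 : ℝ) ≤ N := by exact_mod_cast (by omega : 1 ≤ N)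
  have hNu : IsUnit (N : MvPolynomial σ (ZInv N)) := by
    simpa using (ZInv.isUnit_natCast (dvd_refl N)).map (C : ZInv N →+* MvPolynomial σ (ZInv N))
  have hG0 : G ≠ 0 := by
    rintro rfl
    rw [map_zero] at hG
    exact hg ((hNu.pow E).mul_right_eq_zero.1 hG)
  obtain ⟨m, hm⟩ := ne_zero_iff.1 hG0
  refine ⟨(coeff m G).natAbs, Int.natAbs_ne_zero.2 hm, ?_, fun p hp hpb x z hxz => ?_⟩
  · calc ((coeff m G).natAbs : ℝ) = ((|coeff m G| : ℤ) : ℝ) := by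
          rw [Nat.cast_natAbs]
      _ ≤ (eval 1 P : ℤ) := by exact_mod_cast hP.abs_coeff_le m
      _ ≤ (N : ℝ) ^ (E + H) := hle
      _ ≤ (N : ℝ) ^ (2 * H) := by
          gcongr
          linarith
  · by_cases hpN : p ∣ N
    · have := (ZInv.isUnit_natCast hpN).map (C : ZInv N →+* MvPolynomial σ (ZInv N))
      rw [map_natCast] at this
      exact this.dvd
    · have hprime : Prime (p : MvPolynomial σ (ZInv N)) := by
        rw [← map_natCast C]
        exact (prime_C_iff σ).2 (ZInv.prime_natCast hN hp hpN)
      refine (hprime.dvd_or_dvd (a := map (algebraMap ℤ (ZInv N)) G)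
        ⟨(N : MvPolynomial σ (ZInv N)) ^ E * z, ?_⟩).resolve_left fun hdvd => hpb ?_
      · rw [← hG, mul_assoc, hxz]
        ring
      · rw [← map_natCast C, C_dvd_iff_dvd_coeff] at hdvd
        have := hdvd m
        rw [coeff_map] at this
        exact Int.natCast_dvd.1 (ZInv.dvd_of_natCast_dvd_intCast hN hp hpN this)

end PolynomialHeight

section SpanHeight

open MvPolynomial

variable {σ : Type*} {N : ℕ} {R : Type*} [CommRing R] [Algebra (MvPolynomial σ (ZInv N)) R]
  {ι : Type*} [Fintype ι]

/-- `r` is a linear combination of the family `y` with coefficients of height at most `H`. -/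
def SpanHeightLE (σ : Type*) (N : ℕ) {R : Type*} [CommRing R]
    [Algebra (MvPolynomial σ (ZInv N)) R] {ι : Type*} [Fintype ι] (y : ι → R) (r : R)
    (H : ℝ) : Prop :=
  ∃ f : ι → MvPolynomial σ (ZInv N), ∑ j, f j • y j = r ∧ ∀ j, HeightLE (f j) H

namespace SpanHeightLE

variable {y : ι → R} {r r' : R} {H H' : ℝ}

theorem nonneg [Nonempty ι] (h : SpanHeightLE σ N y r H) : 0 ≤ H := by
  obtain ⟨f, -, hf⟩ := h
  exact (hf (Classical.arbitrary ι)).nonneg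

theorem mono (hN : 2 ≤ N) (h : SpanHeightLE σ N y r H) (hH : H ≤ H') : SpanHeightLE σ N y r H' := by
  obtain ⟨f, hr, hf⟩ := h
  exact ⟨f, hr, fun j => (hf j).mono hN hH⟩

theorem exists_of_span_eq_top (hN : 2 ≤ N)
    (hy : Submodule.span (MvPolynomial σ (ZInv N)) (Set.range y) = ⊤) (r : R) :
    ∃ H, SpanHeightLE σ N y r H := by
  obtain ⟨f, hf⟩ := (Submodule.mem_span_range_iff_exists_fun _).1
    (hy ▸ Submodule.mem_top : r ∈ Submodule.span (MvPolynomial σ (ZInv N)) (Set.range y))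
  obtain ⟨H, -, hH⟩ := HeightLE.exists_forall hN f
  exact ⟨H, f, hf, hH⟩

theorem sum (hN : 2 ≤ N) {κ : Type*} [Fintype κ] [Nonempty κ] {r : κ → R}
    (h : ∀ i, SpanHeightLE σ N y (r i) H) :
    SpanHeightLE σ N y (∑ i, r i) (Real.logb N (Fintype.card κ) + H) := by
  choose f hr hf using h
  refine ⟨fun j => ∑ i, f i j, ?_, fun j => HeightLE.sum hN fun i => hf i j⟩
  simp_rw [Finset.sum_smul]
  rw [Finset.sum_comm]
  exact Finset.sum_congr rfl fun i _ => hr i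

theorem exists_mul (hN : 2 ≤ N) [Nonempty ι]
    (hy : Submodule.span (MvPolynomial σ (ZInv N)) (Set.range y) = ⊤) :
    ∃ K, 0 ≤ K ∧ ∀ (r r' : R) (H H' : ℝ), SpanHeightLE σ N y r H → SpanHeightLE σ N y r' H' →
      SpanHeightLE σ N y (r * r') (K + (H + H')) := by
  have hc : ∀ q : ι × ι, ∃ c : ι → MvPolynomial σ (ZInv N), ∑ j, c j • y j = y q.1 * y q.2 :=
    fun q => (Submodule.mem_span_range_iff_exists_fun _).1 (hy ▸ Submodule.mem_top)
  choose c hc using hc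
  obtain ⟨K, hK, hcK⟩ := HeightLE.exists_forall hN fun q : (ι × ι) × ι => c q.1 q.2
  have hlog : 0 ≤ Real.logb N (Fintype.card (ι × ι)) :=
    Real.logb_nonneg (by exact_mod_cast (by omega : 1 < N)) (by exact_mod_cast Fintype.card_pos)
  refine ⟨Real.logb N (Fintype.card (ι × ι)) + K, by positivity, ?_⟩
  rintro r r' H H' ⟨f, rfl, hf⟩ ⟨g, rfl, hg⟩
  refine ⟨fun j => ∑ q : ι × ι, f q.1 * g q.2 * c q j, ?_, fun j => ?_⟩
  · simp_rw [Finset.sum_smul]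
    rw [Finset.sum_comm, Finset.sum_mul_sum, ← Finset.univ_product_univ, Finset.sum_product]
    refine Finset.sum_congr rfl fun i _ => Finset.sum_congr rfl fun k _ => ?_
    simp_rw [mul_smul]
    rw [← Finset.smul_sum, ← Finset.smul_sum, hc]
    simp only [Algebra.smul_def]
    ring
  · rw [add_assoc, add_comm K]
    exact HeightLE.sum hN fun q => ((hf _).mul hN (hg _)).mul hN (hcK (q, j))

theorem exists_charpoly_coeff (hN : 2 ≤ N) [IsDomain R] [Nonempty ι]
    (hy : Submodule.span (MvPolynomial σ (ZInv N)) (Set.range y) = ⊤) :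
    ∃ K D : ℝ, 0 ≤ K ∧ 0 ≤ D ∧ ∀ r : R, r ≠ 0 → ∀ H, SpanHeightLE σ N y r H →
      ∃ g : MvPolynomial σ (ZInv N), g ≠ 0 ∧ r ∣ algebraMap _ R g ∧ HeightLE g (K + D * H) := by
  classical
  have := ZInv.isDomain hN
  have hc : ∀ q : ι × ι, ∃ c : ι → MvPolynomial σ (ZInv N), ∑ j, c j • y j = y q.1 * y q.2 :=
    fun q => (Submodule.mem_span_range_iff_exists_fun _).1 (hy ▸ Submodule.mem_top)
  choose c hc using hc
  obtain ⟨L, hL, hcL⟩ := HeightLE.exists_forall hN fun q : (ι × ι) × ι => c q.1 q.2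
  have hlog : 0 ≤ Real.logb N (Fintype.card ι) :=
    Real.logb_nonneg (by exact_mod_cast (by omega : 1 < N)) (by exact_mod_cast Fintype.card_pos)
  choose K D hK hD hKD using fun k : ℕ =>
    HeightLE.exists_aeval (σ := σ) hN ((Matrix.charpoly.univ ℤ ι).coeff k)
  set s := Finset.range (Fintype.card ι + 1)
  have hKs : 0 ≤ ∑ k ∈ s, K k := Finset.sum_nonneg fun k _ => hK k
  have hDs : 0 ≤ ∑ k ∈ s, D k := Finset.sum_nonneg fun k _ => hD k
  refine ⟨∑ k ∈ s, K k + (∑ k ∈ s, D k) * (Real.logb N (Fintype.card ι) + L), ∑ k ∈ s, D k,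
    by positivity, hDs, ?_⟩
  rintro r hr H ⟨f, hfr, hf⟩
  have hH : 0 ≤ H := (hf (Classical.arbitrary ι)).nonneg
  set M : ι × ι → MvPolynomial σ (ZInv N) := fun q => ∑ k, f k * c (k, q.1) q.2 with hM
  have hMH : ∀ q, HeightLE (M q) (Real.logb N (Fintype.card ι) + (H + L)) := fun q =>
    HeightLE.sum hN fun k => (hf k).mul hN (hcL ((k, q.1), q.2))
  have hy0 : y ≠ 0 := by
    rintro rfl
    have : (1 : R) ∈ Submodule.span (MvPolynomial σ (ZInv N)) (Set.range (0 : ι → R)) :=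
      hy ▸ Submodule.mem_top
    rw [Submodule.mem_span_range_iff_exists_fun] at this
    simp at this
  have hroot := Matrix.aeval_charpoly_of_forall_mul_eq (Matrix.of M.curry) r hy0 fun i => by
    simp only [Matrix.of_apply, Function.curry_apply, hM, ← Algebra.smul_def, Finset.sum_smul]
    rw [Finset.sum_comm, ← hfr, Finset.sum_mul]
    refine Finset.sum_congr rfl fun k _ => ?_
    simp_rw [mul_smul]
    rw [← Finset.smul_sum, hc, smul_mul_assoc]
  obtain ⟨k, hk0, hk⟩ := Ideal.exists_coeff_ne_zero_mem_comap_of_non_zero_divisor_root_mem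
    (fun {x} hx => (mul_eq_zero.1 hx).resolve_right hr) (Ideal.mem_span_singleton_self r)
    (Matrix.charpoly_monic (Matrix.of M.curry)).ne_zero hroot
  refine ⟨_, hk0, Ideal.mem_span_singleton.1 hk, ?_⟩
  have hks : k ∈ s := by
    have := Polynomial.le_natDegree_of_ne_zero hk0
    rw [Matrix.charpoly_natDegree_eq_dim] at this
    exact Finset.mem_range_succ_iff.2 this
  rw [← Matrix.charpoly.univ_coeff_eval₂Hom ι (algebraMap ℤ _) M k]
  refine (hKD k M _ (by positivity) hMH).mono hN ?_
  have h1 : K k ≤ ∑ k ∈ s, K k := Finset.single_le_sum (fun k _ => hK k) hks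
  have h2 : D k ≤ ∑ k ∈ s, D k := Finset.single_le_sum (fun k _ => hD k) hks
  calc K k + D k * (Real.logb N (Fintype.card ι) + (H + L))
      ≤ ∑ k ∈ s, K k + (∑ k ∈ s, D k) * (Real.logb N (Fintype.card ι) + (H + L)) := by gcongr
    _ = _ := by ring

theorem exists_nat_forall_prime (hN : 2 ≤ N) [IsDomain R] [Finite σ] [Nonempty ι]
    (hinj : Function.Injective (algebraMap (MvPolynomial σ (ZInv N)) R))
    (hy : Submodule.span (MvPolynomial σ (ZInv N)) (Set.range y) = ⊤) :
    ∃ B : ℝ, 1 ≤ B ∧ ∀ r : R, r ≠ 0 → ∀ H : ℝ, 1 ≤ H → SpanHeightLE σ N y r H →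
      ∃ b : ℕ, b ≠ 0 ∧ (b : ℝ) ≤ B ^ H ∧ ∀ p : ℕ, p.Prime → ¬ p ∣ b →
        ∀ x z : R, r * x = p * z → ∃ w, x = p * w := by
  have := ZInv.isDomain hN
  have : FaithfulSMul (MvPolynomial σ (ZInv N)) R :=
    (faithfulSMul_iff_algebraMap_injective _ _).2 hinj
  have : Module.Finite (MvPolynomial σ (ZInv N)) R :=
    ⟨Submodule.fg_def.2 ⟨_, Set.finite_range y, hy⟩⟩
  obtain ⟨κ, φ, n, hn, hφ, hφp⟩ :=
    Module.exists_linearMap_pi_forall_prime (MvPolynomial σ (ZInv N)) R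
  obtain ⟨K, D, hK, hD, hKD⟩ := exists_charpoly_coeff hN hy
  have hN1 : (1 : ℝ) ≤ N := by exact_mod_cast (by omega : 1 ≤ N)
  have hn1 : (1 : ℝ) ≤ n := by exact_mod_cast Nat.one_le_iff_ne_zero.2 hn
  have hB1 : (1 : ℝ) ≤ (N : ℝ) ^ (2 * (K + D)) := Real.one_le_rpow hN1 (by positivity)
  refine ⟨(N : ℝ) ^ (2 * (K + D)) * n, one_le_mul_of_one_le_of_one_le hB1 hn1,
    fun r hr H hH hrH => ?_⟩
  obtain ⟨g, hg0, ⟨r', hr'⟩, hg⟩ := hKD r hr H hrH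
  obtain ⟨b, hb0, hb, hbp⟩ := hg.exists_nat_forall_prime_dvd hN hg0
  refine ⟨b * n, mul_ne_zero hb0 hn, ?_, fun p hp hpb x z hxz => ?_⟩
  · rw [Real.mul_rpow (by positivity) (by positivity), ← Real.rpow_mul (by positivity),
      Nat.cast_mul]
    have h1 : (n : ℝ) ≤ (n : ℝ) ^ H := Real.self_le_rpow_of_one_le hn1 hH
    have h2 : (b : ℝ) ≤ (N : ℝ) ^ (2 * (K + D) * H) := by
      refine hb.trans (Real.rpow_le_rpow_of_exponent_le hN1 ?_)
      nlinarith
    gcongr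
  · have hdvd : ∀ i, ∃ u, φ x i = p * u := fun i => by
      refine hbp p hp (fun h => hpb (h.mul_right n)) _ (φ (r' * z) i) ?_
      have : g • x = p • (r' * z) := by
        rw [Algebra.smul_def, hr', nsmul_eq_mul]
        linear_combination r' * hxz
      have := congrFun (congrArg φ this) i
      rwa [map_smul, map_nsmul, Pi.smul_apply, Pi.smul_apply, smul_eq_mul, nsmul_eq_mul] at this
    choose u hu using hdvd
    obtain ⟨w, hw⟩ := hφp p hp (fun h => hpb (h.mul_left b)) x u (by
      ext1 i
      rw [hu, Pi.smul_apply, nsmul_eq_mul])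
    exact ⟨w, by rw [hw, nsmul_eq_mul]⟩

end SpanHeightLE

/-- The height of `r` with respect to a generating family `y`, shifted so as to be at
least `1`. -/
noncomputable def spanHeight (σ : Type*) (N : ℕ) {R : Type*} [CommRing R]
    [Algebra (MvPolynomial σ (ZInv N)) R] {ι : Type*} [Fintype ι] (y : ι → R) (r : R) : ℝ :=
  sInf {H | SpanHeightLE σ N y r H} + 1

variable {y : ι → R} {r : R} {H : ℝ}

theorem one_le_spanHeight [Nonempty ι] (y : ι → R) (r : R) : 1 ≤ spanHeight σ N y r :=
  le_add_of_nonneg_left (Real.sInf_nonneg fun _ h => SpanHeightLE.nonneg h)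

theorem SpanHeightLE.spanHeight_le [Nonempty ι] (h : SpanHeightLE σ N y r H) :
    spanHeight σ N y r ≤ H + 1 := by
  rw [spanHeight]
  gcongr
  exact csInf_le ⟨0, fun _ h => SpanHeightLE.nonneg h⟩ h

theorem SpanHeightLE.of_spanHeight_lt (hN : 2 ≤ N)
    (hy : Submodule.span (MvPolynomial σ (ZInv N)) (Set.range y) = ⊤)
    (h : spanHeight σ N y r < H + 1) : SpanHeightLE σ N y r H := by
  obtain ⟨H', hH', hlt⟩ := exists_lt_of_csInf_lt
    (SpanHeightLE.exists_of_span_eq_top hN hy r) ((add_lt_add_iff_right 1).1 h)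
  exact SpanHeightLE.mono hN hH' hlt.le

theorem spanHeightLE_spanHeight (hN : 2 ≤ N)
    (hy : Submodule.span (MvPolynomial σ (ZInv N)) (Set.range y) = ⊤) (r : R) :
    SpanHeightLE σ N y r (spanHeight σ N y r) :=
  .of_spanHeight_lt hN hy (lt_add_one _)

theorem spanHeight_sum_le (hN : 2 ≤ N) [Nonempty ι]
    (hy : Submodule.span (MvPolynomial σ (ZInv N)) (Set.range y) = ⊤) {κ : Type*} [Fintype κ]
    [Nonempty κ] {r : κ → R} {B : ℝ} (h : ∀ i, spanHeight σ N y (r i) ≤ B) :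
    spanHeight σ N y (∑ i, r i) ≤ Real.logb N (Fintype.card κ) + B := by
  refine le_of_forall_pos_le_add fun ε hε => ?_
  have := (SpanHeightLE.sum hN fun i => SpanHeightLE.of_spanHeight_lt (H := B - 1 + ε) hN hy
    (by linarith [h i] : spanHeight σ N y (r i) < _)).spanHeight_le
  linarith

theorem exists_spanHeight_prod_le (hN : 2 ≤ N) [Nonempty ι]
    (hy : Submodule.span (MvPolynomial σ (ZInv N)) (Set.range y) = ⊤) :
    ∃ K : ℝ, ∀ (κ : Type) (s : Finset κ) (r : κ → R), s.Nonempty →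
      spanHeight σ N y (∏ i ∈ s, r i) ≤ s.card * K + ∑ i ∈ s, spanHeight σ N y (r i) := by
  obtain ⟨K, hK, hmul⟩ := SpanHeightLE.exists_mul hN hy
  refine ⟨K + 1, fun κ s r hs => ?_⟩
  induction hs using Finset.Nonempty.cons_induction with
  | singleton i =>
    simp only [Finset.prod_singleton, Finset.card_singleton, Finset.sum_singleton]
    push_cast
    linarith
  | cons i s hi hs ih =>
    rw [Finset.prod_cons, Finset.card_cons, Finset.sum_cons]
    have := (hmul _ _ _ _ (spanHeightLE_spanHeight hN hy (r i))
      (spanHeightLE_spanHeight hN hy (∏ i ∈ s, r i))).spanHeight_le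
    push_cast
    linarith

end SpanHeight

theorem stmt9 (N t : ℕ) (hN : 2 ≤ N)
    (R : Type*) [CommRing R] [IsDomain R]
    [Algebra (MvPolynomial (Fin t) (ZInv N)) R]
    (hinj : Function.Injective (algebraMap (MvPolynomial (Fin t) (ZInv N)) R))
    [Module.Finite (MvPolynomial (Fin t) (ZInv N)) R]
    (F : Type*) [Field F] [NumberField F] [IsGalois ℚ F] :
    ∃ (h : R → ℝ) (C : ℝ), (∀ r, 0 ≤ h r) ∧ 1 ≤ C ∧
      (∀ (m : ℕ) (r : Fin m → R) (B : ℝ), 0 < m → (∀ i, h (r i) ≤ B) →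
        h (∑ i, r i) ≤ Real.logb N m + B) ∧
      (∀ (m : ℕ) (r : Fin m → R), 0 < m →
        h (∏ i, r i) ≤ m * C + (t + 1) * ∑ i, h (r i)) ∧
      (∀ r : R, r ≠ 0 → ∀ p : ℕ, p.Prime → C ^ (h r) < (p : ℝ) →
        (r ⊗ₜ[ℤ] (1 : ZMod p)) ∈ nonZeroDivisors (R ⊗[ℤ] ZMod p)) ∧
      (∀ r : R, r ≠ 0 → ∀ n : ℝ, max (N : ℝ) (h r) ≤ n →
        ∃ p : ℕ, p.Prime ∧ (n ≤ p) ∧ ((p : ℝ) ≤ C * n) ∧ SplitsCompletely F p ∧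
          (r ⊗ₜ[ℤ] (1 : ZMod p)) ∈ nonZeroDivisors (R ⊗[ℤ] ZMod p)) := by
  obtain ⟨k, y, hy⟩ := Module.Finite.exists_fin (R := MvPolynomial (Fin t) (ZInv N)) (M := R)
  have hk : Nonempty (Fin k) := by
    by_contra hk
    rw [not_nonempty_iff] at hk
    rw [Set.range_eq_empty, Submodule.span_empty] at hy
    have : (1 : R) ∈ (⊥ : Submodule (MvPolynomial (Fin t) (ZInv N)) R) := hy ▸ Submodule.mem_top
    exact one_ne_zero ((Submodule.mem_bot _).1 this)
  obtain ⟨K, hK⟩ := exists_spanHeight_prod_le hN hy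
  obtain ⟨B, hB, hb⟩ := SpanHeightLE.exists_nat_forall_prime hN hinj hy
  obtain ⟨C, hC, hsplit⟩ := exists_prime_splitsCompletely_not_dvd F hB
  have h1 : ∀ r, 1 ≤ spanHeight (Fin t) N y r := one_le_spanHeight y
  refine ⟨spanHeight (Fin t) N y, max K (max B C), fun r => zero_le_one.trans (h1 r),
    hB.trans ((le_max_left _ _).trans (le_max_right _ _)), ?_, ?_, ?_, ?_⟩
  · intro m r D hm hD
    have : Nonempty (Fin m) := ⟨⟨0, hm⟩⟩
    simpa using spanHeight_sum_le hN hy hD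
  · intro m r hm
    have hsum : 0 ≤ ∑ i, spanHeight (Fin t) N y (r i) :=
      Finset.sum_nonneg fun i _ => zero_le_one.trans (h1 _)
    have h := hK (Fin m) Finset.univ r ⟨⟨0, hm⟩, Finset.mem_univ _⟩
    rw [Finset.card_univ, Fintype.card_fin] at h
    calc spanHeight (Fin t) N y (∏ i, r i)
        ≤ m * K + ∑ i, spanHeight (Fin t) N y (r i) := h
      _ ≤ m * max K (max B C) + (t + 1) * ∑ i, spanHeight (Fin t) N y (r i) := by
          gcongr
          · exact le_max_left _ _
          · exact le_mul_of_one_le_left hsum (le_add_of_nonneg_left (Nat.cast_nonneg t))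
  · intro r hr p hp hlt
    obtain ⟨b, hb0, hbB, hbp⟩ := hb r hr _ (h1 r) (spanHeightLE_spanHeight hN hy r)
    refine tmul_one_mem_nonZeroDivisors (hbp p hp fun hdvd => hlt.not_ge ?_)
    calc (p : ℝ) ≤ b := by exact_mod_cast Nat.le_of_dvd (Nat.pos_of_ne_zero hb0) hdvd
      _ ≤ B ^ spanHeight (Fin t) N y r := hbB
      _ ≤ max K (max B C) ^ spanHeight (Fin t) N y r :=
          Real.rpow_le_rpow (zero_le_one.trans hB) ((le_max_left _ _).trans (le_max_right _ _))
            (zero_le_one.trans (h1 r))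
  · intro r hr n hn
    obtain ⟨b, hb0, hbB, hbp⟩ := hb r hr _ (h1 r) (spanHeightLE_spanHeight hN hy r)
    have hn2 : 2 ≤ n := le_trans (by exact_mod_cast hN) ((le_max_left _ _).trans hn)
    obtain ⟨p, hp, hnp, hpC, hps, hpb⟩ := hsplit n hn2 b hb0
      (hbB.trans (Real.rpow_le_rpow_of_exponent_le hB ((le_max_right _ _).trans hn)))
    refine ⟨p, hp, hnp, hpC.trans ?_, hps, tmul_one_mem_nonZeroDivisors (hbp p hp hpb)⟩
    gcongr
    exact (le_max_right _ _).trans (le_max_right _ _)
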